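/- arXiv:q-alg/9610033 — 7 statements merged into one kernel-verified Lean document; each statement's English description precedes it below -/
import Mathlib

section
/- Let K be a field, n ≥ 1 an integer, and S a subset of {1,…,n}. In the field of fractions K(a_1,…,a_n,y) of the polynomial ring K[a_1,…,a_n,y], define the rational function P̃_S = Σ_{ℓ ∈ S} ∏_{j ≠ ℓ, 1 ≤ j ≤ n} (y − a_j)/(a_ℓ − a_j). Then the element (∏_{s ∈ S} ∏_{r ∉ S} (a_r − a_s)) · P̃_S lies in the image of the polynomial ring K[a_1,…,a_n,y] in its field of fractions; that is, P̃_S can be written as a quotient of polynomials with denominator ∏_{s ∈ S, r ∉ S} (a_r − a_s). -/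
open MvPolynomial

/-- A product of differences `c i - h` agrees with `∏ c i` modulo `h`. -/
theorem dvd_prod_sub_prod_sub {R ι : Type*} [CommRing R] (s : Finset ι) (c : ι → R) (h : R) :
    h ∣ ∏ i ∈ s, c i - ∏ i ∈ s, (c i - h) := by
  classical
  induction s using Finset.induction_on with
  | empty => simp
  | insert i s hi ih =>
    rw [Finset.prod_insert hi, Finset.prod_insert hi]
    obtain ⟨b, hb⟩ := ih
    exact ⟨c i * b + ∏ j ∈ s, (c j - h), by linear_combination c i * hb⟩

/-- Over any domain there is a polynomial of degree less than the number of nodes which takes the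
value `∏ s ∈ S, ∏ r ∉ S, (a r - a s)` at the nodes in `S` and vanishes at the other nodes. -/
theorem exists_polynomial_degree_lt_eval_eq {R ι : Type*} [CommRing R] [IsDomain R] [Fintype ι]
    [DecidableEq ι] (a : ι → R) (S : Finset ι) :
    ∃ f : Polynomial R, f.degree < Fintype.card ι ∧
      ∀ i, f.eval (a i) = if i ∈ S then ∏ s ∈ S, ∏ r ∈ Sᶜ, (a r - a s) else 0 := by
  set H : Polynomial R := ∏ r ∈ Sᶜ, (Polynomial.C (a r) - Polynomial.X) with hH
  set G : Polynomial R := ∏ s ∈ S, (Polynomial.X - Polynomial.C (a s)) with hG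
  have hGm : G.Monic := Polynomial.monic_prod_of_monic _ _ fun s _ => Polynomial.monic_X_sub_C _
  have hGdeg : G.degree = S.card := by simp [hG, Polynomial.degree_prod]
  have hHdeg : H.degree = (Sᶜ.card : ℕ) := by
    have h1 (r : ι) : (Polynomial.C (a r) - Polynomial.X).degree = 1 := by
      rw [← neg_sub, Polynomial.degree_neg, Polynomial.degree_X_sub_C]
    simp [hH, Polynomial.degree_prod, h1]
  have hHeval (x : R) : H.eval x = ∏ r ∈ Sᶜ, (a r - x) := by
    simp [hH, Polynomial.eval_prod]
  obtain ⟨A, hA⟩ := dvd_prod_sub_prod_sub S (fun s => Polynomial.C (H.eval (a s))) H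
  refine ⟨H * (A %ₘ G), ?_, fun i => ?_⟩
  · have hlt := Polynomial.degree_modByMonic_lt A hGm
    rw [hGdeg] at hlt
    rw [Polynomial.degree_mul, hHdeg, ← Finset.card_compl_add_card S, Nat.cast_add]
    exact WithBot.add_lt_add_left (WithBot.natCast_ne_bot _) hlt
  · rw [Polynomial.eval_mul]
    split_ifs with hi
    · have hGi : G.eval (a i) = 0 := by
        rw [hG, Polynomial.eval_prod]
        exact Finset.prod_eq_zero hi (by simp)
      have hmod : (A %ₘ G).eval (a i) = A.eval (a i) := by
        conv_rhs => rw [← Polynomial.modByMonic_add_div A G]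
        simp [hGi]
      have hzero : ∏ s ∈ S, (H.eval (a s) - H.eval (a i)) = 0 :=
        Finset.prod_eq_zero hi (sub_self _)
      have hAi := congrArg (Polynomial.eval (a i)) hA
      simp only [Polynomial.eval_sub, Polynomial.eval_prod, Polynomial.eval_C,
        Polynomial.eval_mul, hzero, sub_zero] at hAi
      rw [hmod, ← hAi]
      exact Finset.prod_congr rfl fun s _ => hHeval _
    · rw [hHeval, Finset.prod_eq_zero (Finset.mem_compl.2 hi) (sub_self _), zero_mul]

/-- Clearing the denominators of a partial sum of Lagrange basis functions. -/
theorem prod_sub_mul_sum_lagrange_mem_range {R F ι : Type*} [CommRing R] [IsDomain R] [Field F]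
    [Algebra R F] [FaithfulSMul R F] [Fintype ι] [DecidableEq ι] {a : ι → R}
    (ha : Function.Injective a) (y : R) (S : Finset ι) :
    (∏ s ∈ S, ∏ r ∈ Sᶜ, (algebraMap R F (a r) - algebraMap R F (a s))) *
        (∑ ℓ ∈ S, ∏ j ∈ Finset.univ.erase ℓ,
          (algebraMap R F y - algebraMap R F (a j)) /
            (algebraMap R F (a ℓ) - algebraMap R F (a j))) ∈
      (algebraMap R F).range := by
  obtain ⟨f, hdeg, hf⟩ := exists_polynomial_degree_lt_eval_eq a S
  refine ⟨f.eval y, ?_⟩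
  have hinterp := Lagrange.eq_interpolate (s := Finset.univ) (v := fun i => algebraMap R F (a i))
    (f := f.map (algebraMap R F))
    ((FaithfulSMul.algebraMap_injective R F).comp ha).injOn
    (Polynomial.degree_map_le.trans_lt (by simpa using hdeg))
  have hy := congrArg (Polynomial.eval (algebraMap R F y)) hinterp
  simp only [Lagrange.interpolate_apply, Polynomial.eval_finsetSum, Polynomial.eval_map_apply,
    hf] at hy
  rw [hy, Finset.mul_sum, ← Finset.sum_subset (Finset.subset_univ S)]
  · refine Finset.sum_congr rfl fun ℓ hℓ => ?_
    simp [hℓ, Lagrange.basis, Lagrange.basisDivisor,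
      Polynomial.eval_prod, div_eq_inv_mul]
  · intro ℓ _ hℓ
    simp [hℓ]

/-- In `K(a_1,…,a_n,y)`, the Lagrange sum
`P̃_S = ∑_{ℓ ∈ S} ∏_{j ≠ ℓ} (y − a_j)/(a_ℓ − a_j)` can be written as a quotient of
polynomials with denominator `∏_{s ∈ S, r ∉ S} (a_r − a_s)`; that is,
`(∏_{s ∈ S} ∏_{r ∉ S} (a_r − a_s)) · P̃_S` lies in the image of the polynomial ring. -/
theorem stmt_0 {K : Type*} [Field K] (n : ℕ) (hn : 1 ≤ n) (S : Finset (Fin n)) :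
    let R := MvPolynomial (Fin n ⊕ Unit) K
    let F := FractionRing R
    let a : Fin n → F := fun j => algebraMap R F (MvPolynomial.X (Sum.inl j))
    let y : F := algebraMap R F (MvPolynomial.X (Sum.inr ()))
    (∏ s ∈ S, ∏ r ∈ Sᶜ, (a r - a s)) *
        (∑ ℓ ∈ S, ∏ j ∈ Finset.univ.erase ℓ, (y - a j) / (a ℓ - a j)) ∈
      (algebraMap R F).range := by
  intro R F a y
  exact prod_sub_mul_sum_lagrange_mem_range
    ((MvPolynomial.X_injective (R := K)).comp Sum.inl_injective) (MvPolynomial.X (Sum.inr ())) S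
end

section
/- Let K be a field of characteristic 0, q ∈ K, and B an n×n matrix over K(x) that is defined at q. Suppose the characteristic polynomial of B splits over K(x) as ∏_{i∈I} (X − r_i)^{m_i} with pairwise distinct r_i ∈ K(x), each defined at q. For i ∈ I let E_i be the eigenprojection of B for r_i, i.e., the idempotent matrix over K(x) whose range is ker (B − r_i)^{m_i} and whose kernel is ⊕_{j≠i} ker (B − r_j)^{m_j}. For c ∈ K put I_c = {i ∈ I : r_i(q) = c} and m_c = Σ_{i∈I_c} m_i. Then the matrix E_c := Σ_{i∈I_c} E_i is defined at q, and its evaluation E_c(q) is the eigenprojection of B(q) for the eigenvalue c: the idempotent matrix over K with range ker (B(q) − c·1)^{m_c} and kernel the direct sum of the spaces ker (B(q) − c'·1)^{m_{c'}} over the other values c' ∈ {r_j(q) : j ∈ I}, c' ≠ c. -/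
set_option maxHeartbeats 1000000
set_option synthInstance.maxHeartbeats 400000
/-- A rational function `f ∈ K(x)` is *defined at* `q ∈ K` if it can be written as a
quotient `g/h` of polynomials with `h(q) ≠ 0`. -/
def DefinedAt {K : Type*} [Field K] (f : RatFunc K) (q : K) : Prop :=
  ∃ g h : Polynomial K, Polynomial.eval q h ≠ 0 ∧
    f = algebraMap (Polynomial K) (RatFunc K) g / algebraMap (Polynomial K) (RatFunc K) h

/-- The value `f(q)` of a rational function at `q`. -/
noncomputable def evalAt {K : Type*} [Field K] (f : RatFunc K) (q : K) : K :=
  RatFunc.eval (RingHom.id K) q f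

open Polynomial

section RationalFunctions

variable {K : Type*} [Field K] {q : K}

theorem definedAt_iff_eval_denom_ne_zero {f : RatFunc K} :
    DefinedAt f q ↔ Polynomial.eval q f.denom ≠ 0 := by
  constructor
  · rintro ⟨g, h, hh, rfl⟩ h0
    have hne : h ≠ 0 := by
      rintro rfl
      simp at hh
    obtain ⟨d, hd⟩ := RatFunc.denom_div_dvd g h
    apply hh
    rw [hd, eval_mul, h0, zero_mul]
  · intro h
    exact ⟨f.num, f.denom, h, (RatFunc.num_div_denom f).symm⟩

theorem DefinedAt.eval₂_denom_ne_zero {f : RatFunc K} (hf : DefinedAt f q) :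
    Polynomial.eval₂ (RingHom.id K) q f.denom ≠ 0 :=
  definedAt_iff_eval_denom_ne_zero.mp hf

theorem definedAt_algebraMap (p : K[X]) : DefinedAt (algebraMap K[X] (RatFunc K) p) q :=
  ⟨p, 1, by simp, by simp⟩

theorem DefinedAt.add {f g : RatFunc K} (hf : DefinedAt f q) (hg : DefinedAt g q) :
    DefinedAt (f + g) q := by
  rw [definedAt_iff_eval_denom_ne_zero] at *
  obtain ⟨d, hd⟩ := RatFunc.denom_add_dvd f g
  intro h0
  have := congrArg (Polynomial.eval q) hd
  simp [eval_mul, h0, hf, hg] at this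

theorem DefinedAt.mul {f g : RatFunc K} (hf : DefinedAt f q) (hg : DefinedAt g q) :
    DefinedAt (f * g) q := by
  rw [definedAt_iff_eval_denom_ne_zero] at *
  obtain ⟨d, hd⟩ := RatFunc.denom_mul_dvd f g
  intro h0
  have := congrArg (Polynomial.eval q) hd
  simp [eval_mul, h0, hf, hg] at this

theorem DefinedAt.neg {f : RatFunc K} (hf : DefinedAt f q) : DefinedAt (-f) q := by
  simpa using (definedAt_algebraMap (q := q) (-1 : K[X])).mul hf

theorem definedAt_inv_of_evalAt_ne_zero {f : RatFunc K} (h0 : evalAt f q ≠ 0) :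
    DefinedAt f⁻¹ q := by
  refine ⟨f.denom, f.num, ?_, ?_⟩
  · intro h
    exact h0 (by simp [evalAt, RatFunc.eval, eval₂_id, h])
  · rw [← inv_div, RatFunc.num_div_denom]

variable (q) in
/-- The local ring of rational functions defined at `q`. -/
def definedSubring : Subring (RatFunc K) where
  carrier := {f | DefinedAt f q}
  mul_mem' := DefinedAt.mul
  add_mem' := DefinedAt.add
  neg_mem' := DefinedAt.neg
  one_mem' := by simpa using definedAt_algebraMap (q := q) (1 : K[X])
  zero_mem' := by simpa using definedAt_algebraMap (q := q) (0 : K[X])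

variable (q) in
/-- Evaluation at `q` as a ring homomorphism. -/
noncomputable def evalAtHom : definedSubring q →+* K where
  toFun f := evalAt (f : RatFunc K) q
  map_one' := RatFunc.eval_one _ _
  map_zero' := RatFunc.eval_zero _ _
  map_mul' f g := RatFunc.eval_mul _ _ f.2.eval₂_denom_ne_zero g.2.eval₂_denom_ne_zero
  map_add' f g := RatFunc.eval_add _ _ f.2.eval₂_denom_ne_zero g.2.eval₂_denom_ne_zero

theorem isUnit_of_evalAtHom_ne_zero {f : definedSubring q} (h : evalAtHom q f ≠ 0) :
    IsUnit f := by
  have hf : (f : RatFunc K) ≠ 0 := by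
    intro h0
    have hf0 : f = 0 := Subtype.ext h0
    exact h (by rw [hf0, map_zero])
  exact IsUnit.of_mul_eq_one ⟨(f : RatFunc K)⁻¹, definedAt_inv_of_evalAt_ne_zero h⟩ (Subtype.ext (mul_inv_cancel₀ hf))

end RationalFunctions

section PolynomialsOfMatrices

open scoped Matrix

variable {n : Type*} [Fintype n] [DecidableEq n]

theorem map_aeval_matrix {R S : Type*} [CommRing R] [CommRing S] (φ : R →+* S)
    (M : Matrix n n R) (p : R[X]) : (aeval M p).map φ = aeval (M.map φ) (p.map φ) := by
  refine map_aeval_eq_aeval_map (φ := φ) (ψ := φ.mapMatrix) ?_ p M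
  ext r i j
  simp [Matrix.algebraMap_matrix_apply, apply_ite φ]

variable {F : Type*} [Field F] (M : Matrix n n F)

theorem aeval_mul_mulVec (p r : F[X]) (w : n → F) :
    aeval M (p * r) *ᵥ w = aeval M p *ᵥ (aeval M r *ᵥ w) := by
  rw [map_mul, Matrix.mulVec_mulVec]

theorem aeval_mulVec_eq_zero_of_dvd {p r : F[X]} (h : p ∣ r) {w : n → F}
    (hw : aeval M p *ᵥ w = 0) : aeval M r *ᵥ w = 0 := by
  obtain ⟨d, rfl⟩ := h
  rw [mul_comm, aeval_mul_mulVec, hw, Matrix.mulVec_zero]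

theorem ker_aeval_prod {ι : Type*} (s : Finset ι) (p : ι → F[X])
    (hp : (s : Set ι).Pairwise fun i j => IsCoprime (p i) (p j)) :
    LinearMap.ker (aeval M (∏ i ∈ s, p i)).mulVecLin =
      ⨆ i ∈ s, LinearMap.ker (aeval M (p i)).mulVecLin := by
  classical
  apply le_antisymm
  · induction s using Finset.induction_on with
    | empty => intro w hw; simpa using hw
    | insert a s ha ih =>
      intro w hw
      have hcop : IsCoprime (p a) (∏ i ∈ s, p i) := by
        refine IsCoprime.prod_right fun i hi => hp (by simp) (by simp [hi]) ?_
        rintro rfl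
        exact ha hi
      obtain ⟨u, v, huv⟩ := hcop
      rw [Finset.prod_insert ha] at hw
      have hw' : aeval M (p a * ∏ i ∈ s, p i) *ᵥ w = 0 := hw
      have hsum : w = aeval M (v * ∏ i ∈ s, p i) *ᵥ w + aeval M (u * p a) *ᵥ w := by
        rw [← Matrix.add_mulVec, ← map_add, add_comm, huv, map_one, Matrix.one_mulVec]
      rw [Finset.iSup_insert, hsum]
      refine Submodule.add_mem_sup ?_ (ih (hp.mono (by simp)) ?_)
      · change aeval M (p a) *ᵥ (_ *ᵥ w) = 0
        rw [← aeval_mul_mulVec]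
        exact aeval_mulVec_eq_zero_of_dvd M ⟨v, by ring⟩ hw'
      · change aeval M (∏ i ∈ s, p i) *ᵥ (_ *ᵥ w) = 0
        rw [← aeval_mul_mulVec]
        exact aeval_mulVec_eq_zero_of_dvd M ⟨u, by ring⟩ hw'
  · refine iSup₂_le fun i hi w hw => ?_
    exact aeval_mulVec_eq_zero_of_dvd M (Finset.dvd_prod_of_mem p hi) hw

variable {f g u v : F[X]}

theorem aeval_bezout_mul_self (huv : u * f + v * g = 1) (hfg : aeval M (f * g) = 0) :
    aeval M (v * g) * aeval M (v * g) = aeval M (v * g) := by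
  have h : v * g * (v * g) = v * g - u * v * (f * g) := by linear_combination (v * g) * huv
  rw [← map_mul, h, map_sub, map_mul _ (u * v), hfg, mul_zero, sub_zero]

theorem range_aeval_bezout (huv : u * f + v * g = 1) (hfg : aeval M (f * g) = 0) :
    LinearMap.range (aeval M (v * g)).mulVecLin = LinearMap.ker (aeval M f).mulVecLin := by
  ext w
  constructor
  · rintro ⟨w, rfl⟩
    change aeval M f *ᵥ (aeval M (v * g) *ᵥ w) = 0
    rw [← aeval_mul_mulVec, show f * (v * g) = v * (f * g) by ring, map_mul, hfg, mul_zero,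
      Matrix.zero_mulVec]
  · intro hw
    refine ⟨w, ?_⟩
    have hw' : aeval M f *ᵥ w = 0 := hw
    change aeval M (v * g) *ᵥ w = w
    rw [show v * g = 1 - u * f by linear_combination huv, map_sub, Matrix.sub_mulVec,
      aeval_mul_mulVec, hw', Matrix.mulVec_zero, map_one, Matrix.one_mulVec, sub_zero]

theorem ker_aeval_bezout (huv : u * f + v * g = 1) (hfg : aeval M (f * g) = 0) :
    LinearMap.ker (aeval M (v * g)).mulVecLin = LinearMap.ker (aeval M g).mulVecLin := by
  ext w
  constructor
  · intro hw
    have hw' : aeval M (v * g) *ᵥ w = 0 := hw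
    change aeval M g *ᵥ w = 0
    rw [show g = g * (v * g) + u * (f * g) by linear_combination (-g) * huv, map_add,
      map_mul _ u, hfg, mul_zero, add_zero, aeval_mul_mulVec, hw', Matrix.mulVec_zero]
  · intro hw
    exact aeval_mulVec_eq_zero_of_dvd M (Dvd.intro_left v rfl) hw

theorem aeval_X_sub_C_pow (a : F) (k : ℕ) :
    aeval M ((X - C a) ^ k) = (M - a • (1 : Matrix n n F)) ^ k := by
  rw [map_pow, map_sub, aeval_X, aeval_C, Algebra.algebraMap_eq_smul_one]

/-- Idempotents `E i` projecting onto the members of a family of subspaces along the sum of the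
other members: a sum of some of them is determined by its action on each member. -/
theorem sum_projections_eq {ι : Type*} [Nonempty ι] [DecidableEq ι]
    (W : ι → Submodule F (n → F)) (E : ι → Matrix n n F)
    (hidem : ∀ i, E i * E i = E i)
    (hrange : ∀ i, LinearMap.range (E i).mulVecLin = W i)
    (hker : ∀ i, LinearMap.ker (E i).mulVecLin = ⨆ j ∈ ({j | j ≠ i} : Set ι), W j)
    (s : Finset ι) (P : Matrix n n F)
    (hmem : ∀ i ∈ s, ∀ w ∈ W i, P *ᵥ w = w) (hnot : ∀ i ∉ s, ∀ w ∈ W i, P *ᵥ w = 0) :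
    ∑ i ∈ s, E i = P := by
  have hself : ∀ i, ∀ w ∈ W i, E i *ᵥ w = w := by
    intro i w hw
    rw [← hrange i] at hw
    obtain ⟨w, rfl⟩ := hw
    rw [Matrix.mulVecLin_apply, Matrix.mulVec_mulVec, hidem]
  have hother : ∀ i j, j ≠ i → ∀ w ∈ W j, E i *ᵥ w = 0 := by
    intro i j hij w hw
    have : w ∈ LinearMap.ker (E i).mulVecLin := by
      rw [hker i]
      exact Submodule.mem_iSup_of_mem j (Submodule.mem_iSup_of_mem hij hw)
    exact this
  have htop : ⨆ j, W j = ⊤ := by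
    obtain ⟨i⟩ := ‹Nonempty ι›
    rw [eq_top_iff]
    intro w _
    have h1 : E i *ᵥ w ∈ ⨆ j, W j :=
      Submodule.mem_iSup_of_mem i (hrange i ▸ ⟨w, rfl⟩)
    have h2 : w - E i *ᵥ w ∈ ⨆ j, W j := by
      have : w - E i *ᵥ w ∈ LinearMap.ker (E i).mulVecLin := by
        simp [Matrix.mulVec_sub, Matrix.mulVec_mulVec, hidem]
      rw [hker i] at this
      exact (iSup₂_le fun j _ => le_iSup W j) this
    simpa using add_mem h1 h2
  have hle : ⨆ j, W j ≤ LinearMap.eqLocus (∑ i ∈ s, E i).mulVecLin P.mulVecLin := by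
    refine iSup_le fun j w hw => ?_
    change (∑ i ∈ s, E i) *ᵥ w = P *ᵥ w
    rw [Matrix.sum_mulVec]
    by_cases hj : j ∈ s
    · rw [hmem j hj w hw, Finset.sum_eq_single_of_mem j hj fun i _ hij => hother i j hij.symm w hw,
        hself j w hw]
    · rw [hnot j hj w hw]
      refine Finset.sum_eq_zero fun i hi => hother i j ?_ w hw
      rintro rfl
      exact hj hi
  rw [htop] at hle
  apply Matrix.mulVec_injective
  funext w
  exact hle (Submodule.mem_top (x := w))

end PolynomialsOfMatrices

/-- Let `B` be a square matrix over `K(x)`, defined at `q`, whose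
characteristic polynomial splits as `∏ i, (X - r i)^(m i)` with pairwise distinct
`r i`, each defined at `q`, and let `E i` be the eigenprojection of `B` for `r i`.
For an eigenvalue `c` of `B(q)` (i.e. `c = r i (q)` for some `i`), the sum
`E_c = ∑_{r i (q) = c} E i` is defined at `q`, and its evaluation at `q` is the
eigenprojection of `B(q)` for `c`: idempotent, with range the generalized eigenspace
`ker (B(q) - c·1)^{m_c}` (`m_c = ∑_{r i (q) = c} m i`) and kernel the sum of the
generalized eigenspaces of the other eigenvalues `c' ∈ {r j (q)}`, `c' ≠ c`. -/
theorem stmt_5 {K : Type*} [Field K] [CharZero K] [DecidableEq K] (q : K) (n : ℕ)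
    (B : Matrix (Fin n) (Fin n) (RatFunc K))
    (hB : ∀ i j, DefinedAt (B i j) q)
    {I : Type*} [Fintype I] [DecidableEq I] (r : I → RatFunc K) (m : I → ℕ)
    (hr : Function.Injective r)
    (hrq : ∀ i, DefinedAt (r i) q)
    (hchar : B.charpoly = ∏ i, (X - C (r i)) ^ (m i))
    (E : I → Matrix (Fin n) (Fin n) (RatFunc K))
    (hidem : ∀ i, E i * E i = E i)
    (hrange : ∀ i, LinearMap.range (E i).mulVecLin =
      LinearMap.ker ((B - r i • (1 : Matrix (Fin n) (Fin n) (RatFunc K))) ^ (m i)).mulVecLin)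
    (hker : ∀ i, LinearMap.ker (E i).mulVecLin =
      ⨆ j ∈ ({j | j ≠ i} : Set I),
        LinearMap.ker ((B - r j • (1 : Matrix (Fin n) (Fin n) (RatFunc K))) ^ (m j)).mulVecLin)
    (c : K) (hc : ∃ i, evalAt (r i) q = c) :
    let Ic : Finset I := Finset.univ.filter fun i => evalAt (r i) q = c
    let Ec : Matrix (Fin n) (Fin n) (RatFunc K) := ∑ i ∈ Ic, E i
    let mc : ℕ := ∑ i ∈ Ic, m i
    let Bq : Matrix (Fin n) (Fin n) K := B.map fun f => evalAt f q
    let Ecq : Matrix (Fin n) (Fin n) K := Ec.map fun f => evalAt f q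
    (∀ a b, DefinedAt (Ec a b) q) ∧
    Ecq * Ecq = Ecq ∧
    LinearMap.range Ecq.mulVecLin =
      LinearMap.ker ((Bq - c • (1 : Matrix (Fin n) (Fin n) K)) ^ mc).mulVecLin ∧
    LinearMap.ker Ecq.mulVecLin =
      ⨆ c' ∈ {c' : K | c' ≠ c ∧ ∃ j, evalAt (r j) q = c'},
        LinearMap.ker ((Bq - c' • (1 : Matrix (Fin n) (Fin n) K)) ^
          (∑ j ∈ Finset.univ.filter fun j => evalAt (r j) q = c', m j)).mulVecLin := by
  intro Ic Ec mc Bq Ecq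
  let φ := evalAtHom q
  let ι := (definedSubring q).subtype
  have hι : Function.Injective ι := Subtype.val_injective
  let BA : Matrix (Fin n) (Fin n) (definedSubring q) := Matrix.of fun i j => ⟨B i j, hB i j⟩
  let ρ : I → definedSubring q := fun i => ⟨r i, hrq i⟩
  have hBι : BA.map ι = B := rfl
  have hBφ : BA.map φ = Bq := rfl
  let f : (definedSubring q)[X] := ∏ i ∈ Ic, (X - C (ρ i)) ^ m i
  let g : (definedSubring q)[X] := ∏ i ∈ Finset.univ.filter fun i => ¬ evalAt (r i) q = c,
    (X - C (ρ i)) ^ m i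
  have hfg : BA.charpoly = f * g := by
    apply map_injective ι hι
    rw [← Matrix.charpoly_map, hBι, hchar, Finset.prod_filter_mul_prod_filter_not,
      Polynomial.map_prod]
    simp only [Polynomial.map_pow, Polynomial.map_sub, map_X, map_C]
    rfl
  have hcop : IsCoprime f g := by
    refine IsCoprime.prod_left fun i hi => IsCoprime.prod_right fun j hj => IsCoprime.pow ?_
    refine isCoprime_X_sub_C_of_isUnit_sub (isUnit_of_evalAtHom_ne_zero ?_)
    rw [map_sub, sub_ne_zero]
    intro h
    exact (Finset.mem_filter.mp hj).2 (h.symm.trans (Finset.mem_filter.mp hi).2)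
  obtain ⟨u, v, huv⟩ := hcop
  have hmap : ∀ {S : Type _} [CommRing S] (ψ : definedSubring q →+* S),
      u.map ψ * f.map ψ + v.map ψ * g.map ψ = 1 := fun ψ => by
    rw [← Polynomial.map_mul, ← Polynomial.map_mul, ← Polynomial.map_add, huv, Polynomial.map_one]
  have hdvd : ∀ (s : Finset I), ∀ i ∈ s,
      (X - C (r i)) ^ m i ∣ (∏ i ∈ s, (X - C (ρ i)) ^ m i).map ι := fun s i hi => by
    rw [Polynomial.map_prod]
    refine dvd_trans (dvd_of_eq ?_) (Finset.dvd_prod_of_mem _ hi)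
    simp only [Polynomial.map_pow, Polynomial.map_sub, map_X, map_C]
    rfl
  have hEc : Ec = (aeval BA (v * g)).map ι := by
    have : Nonempty I := ⟨hc.choose⟩
    rw [map_aeval_matrix, hBι, Polynomial.map_mul]
    refine sum_projections_eq _ E hidem hrange hker Ic _ ?_ ?_
    · intro i hi w hw
      rw [← aeval_X_sub_C_pow] at hw
      have hw' := aeval_mulVec_eq_zero_of_dvd B ((hdvd Ic i hi).mul_left (u.map ι)) hw
      change (aeval B (u.map ι * f.map ι)).mulVec w = 0 at hw'
      rw [← zero_add (Matrix.mulVec _ w), ← hw', ← Matrix.add_mulVec, ← map_add, hmap ι, map_one,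
        Matrix.one_mulVec]
    · intro i hi w hw
      rw [← aeval_X_sub_C_pow] at hw
      refine aeval_mulVec_eq_zero_of_dvd B ((hdvd _ i ?_).mul_left _) hw
      simpa [Ic] using hi
  have hEcq : Ecq = aeval Bq (v.map φ * g.map φ) := by
    rw [← hBφ, ← Polynomial.map_mul, ← map_aeval_matrix]
    change Ec.map _ = _
    rw [hEc]
    rfl
  have hann : aeval Bq (f.map φ * g.map φ) = 0 := by
    rw [← Polynomial.map_mul, ← hfg, ← Matrix.charpoly_map, hBφ, Matrix.aeval_self_charpoly]
  have hfφ : f.map φ = (X - C c) ^ mc := by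
    rw [Polynomial.map_prod, ← Finset.prod_pow_eq_pow_sum]
    refine Finset.prod_congr rfl fun i hi => ?_
    rw [Polynomial.map_pow, Polynomial.map_sub, map_X, map_C]
    congr 3
    exact (Finset.mem_filter.mp hi).2
  let T : Finset K := (Finset.univ.image fun j => evalAt (r j) q).erase c
  have hgφ : g.map φ = ∏ c' ∈ T,
      (X - C c') ^ (∑ j ∈ Finset.univ.filter fun j => evalAt (r j) q = c', m j) := by
    rw [Polynomial.map_prod, ← Finset.prod_fiberwise_of_maps_to (t := T)
      (g := fun j => evalAt (r j) q)]
    · refine Finset.prod_congr rfl fun c' hc' => ?_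
      rw [← Finset.prod_pow_eq_pow_sum, Finset.filter_filter]
      refine Finset.prod_congr ?_ fun i hi => ?_
      · ext i
        have := Finset.ne_of_mem_erase hc'
        simp only [Finset.mem_filter, Finset.mem_univ, true_and]
        constructor
        · exact fun h => h.2
        · rintro rfl
          exact ⟨this, rfl⟩
      · rw [Polynomial.map_pow, Polynomial.map_sub, map_X, map_C]
        congr 3
        exact (Finset.mem_filter.mp hi).2
    · intro i hi
      exact Finset.mem_erase.mpr ⟨(Finset.mem_filter.mp hi).2, by simp⟩
  refine ⟨fun a b => ?_, ?_, ?_, ?_⟩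
  · rw [hEc]
    exact (aeval BA (v * g) a b).2
  · rw [hEcq]
    exact aeval_bezout_mul_self Bq (hmap φ) hann
  · rw [hEcq, range_aeval_bezout Bq (hmap φ) hann, hfφ, aeval_X_sub_C_pow]
  · rw [hEcq, ker_aeval_bezout Bq (hmap φ) hann, hgφ, ker_aeval_prod]
    · simp only [aeval_X_sub_C_pow]
      refine iSup_congr fun c' => ?_
      have : (c' ∈ T) = (c' ∈ {c' : K | c' ≠ c ∧ ∃ j, evalAt (r j) q = c'}) := by
        simp [T]
      rw [this]
    · intro a _ b _ hab
      exact (isCoprime_X_sub_C_of_isUnit_sub (sub_ne_zero.mpr hab).isUnit).pow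
end

section
/- Let K be a field of characteristic 0 and, for each nonzero integer d, let a_d = (1 − x^{d+1})/(1 − x^d) ∈ K(x). Then for all integers r ≥ 2 and s ≥ 1 the following identity holds in K(x): ∏_{i=0}^{s} (a_{r+i} · a_{−(r+i)})^{s+1−i} = x^{(s+1)(s+2)/2} · a_{r−1}^{−(s+1)} · (1 − x^{r+s+1})/(1 − x^r). -/
theorem prod_range_mul_second_ratio {F : Type*} [Field F] (x : F) (b : ℕ → F)
    (hb : ∀ n, b n ≠ 0) (n : ℕ) :
    ∏ i ∈ Finset.range n, x * b (i + 2) * b i / b (i + 1) ^ 2 =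
      x ^ n * (b 0 / b 1) * (b (n + 1) / b n) := by
  induction n with
  | zero =>
    have h0 := hb 0
    have h1 := hb 1
    simp
    field_simp
  | succ n ih =>
    rw [Finset.prod_range_succ, ih]
    have h0 := hb n
    have h1 := hb 1
    have h2 := hb (n + 1)
    field_simp
    ring

theorem prod_range_mul_second_ratio_pow {F : Type*} [Field F] (x : F) (b : ℕ → F)
    (hb : ∀ n, b n ≠ 0) (n : ℕ) :
    ∏ i ∈ Finset.range n, (x * b (i + 2) * b i / b (i + 1) ^ 2) ^ (n - i) =
      x ^ (n * (n + 1) / 2) * (b 0 / b 1) ^ n * (b (n + 1) / b 1) := by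
  induction n with
  | zero => simp [hb 1]
  | succ n ih =>
    have key : ∏ i ∈ Finset.range (n + 1),
        (x * b (i + 2) * b i / b (i + 1) ^ 2) ^ (n + 1 - i) =
        (∏ i ∈ Finset.range n, (x * b (i + 2) * b i / b (i + 1) ^ 2) ^ (n - i)) *
          ∏ i ∈ Finset.range (n + 1), x * b (i + 2) * b i / b (i + 1) ^ 2 := by
      rw [Finset.prod_range_succ, Finset.prod_range_succ _ n, ← mul_assoc,
        ← Finset.prod_mul_distrib, Nat.add_sub_cancel_left, pow_one]
      congr 1
      refine Finset.prod_congr rfl fun i hi => ?_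
      rw [Nat.succ_sub (Finset.mem_range.mp hi).le, pow_succ]
    have htri : (n + 1) * (n + 1 + 1) / 2 = n * (n + 1) / 2 + (n + 1) := by
      rw [show (n + 1) * (n + 1 + 1) = n * (n + 1) + (n + 1) * 2 by ring,
        Nat.add_mul_div_right _ _ two_pos]
    rw [key, ih, prod_range_mul_second_ratio x b hb, htri, pow_add, pow_succ (b 0 / b 1)]
    have h1 := hb 1
    have h2 := hb (n + 1)
    field_simp
    ring

theorem RatFunc.one_sub_X_pow_ne_zero {K : Type*} [Field K] {n : ℕ} (hn : n ≠ 0) :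
    (1 - RatFunc.X ^ n : RatFunc K) ≠ 0 := by
  rw [← RatFunc.algebraMap_X, ← map_pow, ← map_one (algebraMap (Polynomial K) (RatFunc K)),
    ← map_sub]
  refine RatFunc.algebraMap_ne_zero fun h => ?_
  have := congrArg (Polynomial.eval 0) h
  simp [hn] at this

theorem one_sub_pow_ratio_mul_neg {F : Type*} [Field F] {x : F} (hx : x ≠ 0) (m : ℕ)
    (hm : 1 - x ^ (m + 1) ≠ 0) :
    (1 - x ^ ((m + 1 : ℤ) + 1)) / (1 - x ^ (m + 1 : ℤ)) *
        ((1 - x ^ (-(m + 1 : ℤ) + 1)) / (1 - x ^ (-(m + 1 : ℤ)))) =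
      x * (1 - x ^ (m + 2)) * (1 - x ^ m) / (1 - x ^ (m + 1)) ^ 2 := by
  have e1 : x ^ ((m + 1 : ℤ) + 1) = x ^ (m + 2) := by
    rw [← zpow_natCast]; congr 1
  have e2 : x ^ (m + 1 : ℤ) = x ^ (m + 1) := by
    rw [← zpow_natCast]; congr 1
  have e3 : x ^ (-(m + 1 : ℤ) + 1) = (x ^ m)⁻¹ := by
    rw [← zpow_natCast, ← zpow_neg]; congr 1; ring
  have hxm := pow_ne_zero m hx
  have hxm1 := pow_ne_zero (m + 1) hx
  have e4 : 1 - (x ^ (m + 1))⁻¹ = -(1 - x ^ (m + 1)) / x ^ (m + 1) := by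
    field_simp; ring
  have e5 : 1 - (x ^ m)⁻¹ = -(1 - x ^ m) / x ^ m := by
    field_simp; ring
  rw [e1, zpow_neg, e2, e3, e4, e5, div_div_div_eq, div_mul_div_comm,
    div_eq_div_iff (mul_ne_zero hm (mul_ne_zero hxm (neg_ne_zero.mpr hm))) (pow_ne_zero 2 hm)]
  ring


/-- With `a_d = (1 - x^(d+1))/(1 - x^d) ∈ K(x)` for nonzero integers
`d`, for all integers `r ≥ 2`, `s ≥ 1` one has
`∏_{i=0}^{s} (a_{r+i} a_{-(r+i)})^{s+1-i}
  = x^{(s+1)(s+2)/2} · a_{r-1}^{-(s+1)} · (1 - x^{r+s+1})/(1 - x^r)`. -/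
theorem stmt_7 {K : Type*} [Field K] [CharZero K]
    (a : ℤ → RatFunc K)
    (ha : ∀ d : ℤ, a d = (1 - RatFunc.X ^ (d + 1)) / (1 - RatFunc.X ^ d))
    (r s : ℕ) (hr : 2 ≤ r) (hs : 1 ≤ s) :
    ∏ i ∈ Finset.range (s + 1), (a ((r : ℤ) + i) * a (-((r : ℤ) + i))) ^ (s + 1 - i) =
      RatFunc.X ^ ((s + 1) * (s + 2) / 2) * a ((r : ℤ) - 1) ^ (-((s : ℤ) + 1)) *
        ((1 - RatFunc.X ^ (r + s + 1)) / (1 - RatFunc.X ^ r)) := by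
  obtain ⟨k, rfl⟩ : ∃ k, r = k + 2 := ⟨r - 2, by omega⟩
  have hb (n : ℕ) : (1 - RatFunc.X ^ (k + 1 + n) : RatFunc K) ≠ 0 :=
    RatFunc.one_sub_X_pow_ne_zero (by omega)
  have hterm (i : ℕ) : a (((k + 2 : ℕ) : ℤ) + i) * a (-(((k + 2 : ℕ) : ℤ) + i)) =
      RatFunc.X * (1 - RatFunc.X ^ (k + 1 + (i + 2))) * (1 - RatFunc.X ^ (k + 1 + i)) /
        (1 - RatFunc.X ^ (k + 1 + (i + 1))) ^ 2 := by
    have hcast : ((k + 2 : ℕ) : ℤ) + i = ((k + 1 + i : ℕ) : ℤ) + 1 := by push_cast; ring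
    rw [ha, ha, hcast]
    exact one_sub_pow_ratio_mul_neg RatFunc.X_ne_zero (k + 1 + i) (hb (i + 1))
  have hinv : a (((k + 2 : ℕ) : ℤ) - 1) ^ (-((s : ℤ) + 1)) =
      ((1 - RatFunc.X ^ (k + 1 + 0)) / (1 - RatFunc.X ^ (k + 1 + 1))) ^ (s + 1) := by
    rw [ha, show ((k + 2 : ℕ) : ℤ) - 1 + 1 = ((k + 1 + 1 : ℕ) : ℤ) by push_cast; ring,
      show ((k + 2 : ℕ) : ℤ) - 1 = ((k + 1 + 0 : ℕ) : ℤ) by push_cast; ring,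
      zpow_natCast, zpow_natCast, show -((s : ℤ) + 1) = -((s + 1 : ℕ) : ℤ) by push_cast; ring,
      zpow_neg, zpow_natCast, ← inv_pow, inv_div]
  simp only [hterm]
  rw [hinv, prod_range_mul_second_ratio_pow RatFunc.X
    (fun n => 1 - RatFunc.X ^ (k + 1 + n)) hb (s + 1),
    show k + 2 + s + 1 = k + 1 + (s + 1 + 1) by ring]
end

section
/- Fix integers k ≥ 1 and l ≥ 1. Define a relation on ℤ^k by: y → y' if there exist indices a ≠ b in {1,…,k} and an integer m such that y'_a = y_b + m·l, y'_b = y_a − m·l, and y'_c = y_c for all c ∉ {a,b} (that is, y' is the image of y under the affine reflection in the hyperplane v_a − v_b = m·l). Then for y, z ∈ ℤ^k the following are equivalent: (1) z can be obtained from y by a finite sequence of such moves (i.e., z lies in the orbit of y under the group generated by these affine reflections); (2) Σ_{i=1}^{k} z_i = Σ_{i=1}^{k} y_i, and for every integer r the number of indices i with y_i ≡ r (mod l) equals the number of indices i with z_i ≡ r (mod l). -/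
/-- One affine-reflection move on `ℤ^k`: `y'` is obtained from `y` by the affine
reflection in a hyperplane `v_a - v_b = m·l` (it interchanges coordinates `a` and `b`
up to shifts `±m·l` and fixes the remaining coordinates). -/
def ReflMove (k : ℕ) (l : ℤ) (y y' : Fin k → ℤ) : Prop :=
  ∃ a b : Fin k, a ≠ b ∧ ∃ m : ℤ,
    y' a = y b + m * l ∧ y' b = y a - m * l ∧ ∀ c : Fin k, c ≠ a → c ≠ b → y' c = y c

namespace ReflMove

variable {k : ℕ} {l : ℤ}

theorem iff_swap_add_single {y y' : Fin k → ℤ} :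
    ReflMove k l y y' ↔ ∃ a b : Fin k, a ≠ b ∧ ∃ m : ℤ,
      y' = y ∘ Equiv.swap a b + (Pi.single a (m * l) - Pi.single b (m * l)) := by
  refine exists_congr fun a => exists_congr fun b => and_congr_right fun hab =>
    exists_congr fun m => ⟨?_, ?_⟩
  · rintro ⟨ha, hb, hc⟩
    ext c
    rcases eq_or_ne c a with rfl | hca
    · simp [ha, hab]
    rcases eq_or_ne c b with rfl | hcb
    · simp [hb, hca, sub_eq_add_neg]
    simp [hc c hca hcb, Equiv.swap_apply_of_ne_of_ne hca hcb, hca, hcb]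
  · rintro rfl
    refine ⟨by simp [hab], by simp [hab.symm, sub_eq_add_neg], fun c hca hcb => ?_⟩
    simp [Equiv.swap_apply_of_ne_of_ne hca hcb, hca, hcb]

theorem sum_eq {y y' : Fin k → ℤ} (h : ReflMove k l y y') : ∑ i, y' i = ∑ i, y i := by
  obtain ⟨a, b, -, m, rfl⟩ := iff_swap_add_single.1 h
  simp [Finset.sum_add_distrib, Equiv.sum_comp (Equiv.swap a b) y]

theorem card_filter_emod_eq {y y' : Fin k → ℤ} (h : ReflMove k l y y') (r : ℤ) :
    (Finset.univ.filter fun i => y i % l = r).card =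
      (Finset.univ.filter fun i => y' i % l = r).card := by
  obtain ⟨a, b, -, m, rfl⟩ := iff_swap_add_single.1 h
  refine Finset.card_equiv (Equiv.swap a b) fun i => ?_
  have hdvd (c j : Fin k) : l ∣ (Pi.single c (m * l) : Fin k → ℤ) j := by
    rw [Pi.single_apply]
    split_ifs <;> simp
  have hmod : (y i + ((Pi.single a (m * l) : Fin k → ℤ) (Equiv.swap a b i) -
      (Pi.single b (m * l) : Fin k → ℤ) (Equiv.swap a b i))) % l = y i % l :=
    Int.emod_eq_emod_iff_emod_sub_eq_zero.2 <| Int.emod_eq_zero_of_dvd <| by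
      simpa using dvd_sub (hdvd a _) (hdvd b _)
  simp [hmod]

theorem reflTransGen_comp_perm (σ : Equiv.Perm (Fin k)) (y : Fin k → ℤ) :
    Relation.ReflTransGen (ReflMove k l) y (y ∘ σ) := by
  induction σ using Equiv.Perm.swap_induction_on generalizing y with
  | one => exact .refl
  | swap_mul σ a b hab ih =>
    exact .head (iff_swap_add_single.2 ⟨a, b, hab, 0, by simp⟩) (ih (y ∘ Equiv.swap a b))

theorem reflTransGen_add_single_sub_single (a b : Fin k) (m : ℤ) (y : Fin k → ℤ) :
    Relation.ReflTransGen (ReflMove k l) y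
      (y + (Pi.single a (m * l) - Pi.single b (m * l))) := by
  rcases eq_or_ne a b with rfl | hab
  · simpa using Relation.ReflTransGen.refl
  · refine (reflTransGen_comp_perm (Equiv.swap a b) y).tail
      (iff_swap_add_single.2 ⟨a, b, hab, m, ?_⟩)
    ext c
    simp

/-- The translations that preserve every orbit. -/
def translations (k : ℕ) (l : ℤ) : AddSubmonoid (Fin k → ℤ) where
  carrier := {t | ∀ y, Relation.ReflTransGen (ReflMove k l) y (y + t)}
  zero_mem' y := by simpa using Relation.ReflTransGen.refl
  add_mem' hs ht y := by simpa [add_assoc] using (hs y).trans (ht _)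

theorem mul_mem_translations {t : Fin k → ℤ} (ht : ∑ i, t i = 0) :
    (fun i => t i * l) ∈ translations k l := by
  rcases isEmpty_or_nonempty (Fin k) with _ | ⟨⟨b⟩⟩
  · exact Subsingleton.elim 0 (fun i => t i * l) ▸ zero_mem _
  · have key : (fun i => t i * l) = ∑ a, (Pi.single a (t a * l) - Pi.single b (t a * l)) := by
      rw [Finset.sum_sub_distrib, Finset.univ_sum_single fun i => t i * l]
      ext c
      rcases eq_or_ne c b with rfl | hcb
      · simp [← Finset.sum_mul, ht]
      · simp [hcb]
    rw [key]
    exact sum_mem fun a _ y => reflTransGen_add_single_sub_single a b (t a) y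

end ReflMove

theorem exists_perm_emod_eq {k : ℕ} {l : ℤ} {y z : Fin k → ℤ}
    (h : ∀ r : ℤ, (Finset.univ.filter fun i => y i % l = r % l).card =
      (Finset.univ.filter fun i => z i % l = r % l).card) :
    ∃ σ : Equiv.Perm (Fin k), ∀ i, z i % l = y (σ i) % l := by
  have hcard (r : ℤ) : Fintype.card {i // z i % l = r} = Fintype.card {i // y i % l = r} := by
    rw [Fintype.card_subtype, Fintype.card_subtype]
    by_cases hr : r % l = r
    · simpa [hr] using (h r).symm
    · have hne (x : ℤ) : x % l ≠ r := by
        rintro rfl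
        exact hr (Int.emod_emod_of_dvd x dvd_rfl)
      simp [hne]
  exact ⟨Equiv.ofFiberEquiv fun r => Fintype.equivOfCardEq (hcard r),
    fun i => (Equiv.ofFiberEquiv_map (f := fun j => z j % l) (g := fun j => y j % l) _ i).symm⟩

/-- For `y, z ∈ ℤ^k`, `z` lies in the orbit of `y` under the group
generated by the affine reflections in the hyperplanes `v_a - v_b = m·l` if and only
if `z` and `y` have the same coordinate sum and, for every residue `r` mod `l`, the
same number of coordinates congruent to `r` mod `l`. -/
theorem stmt_9 (k : ℕ) (hk : 1 ≤ k) (l : ℤ) (hl : 1 ≤ l) (y z : Fin k → ℤ) :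
    Relation.ReflTransGen (ReflMove k l) y z ↔
      ((∑ i, z i) = (∑ i, y i) ∧
        ∀ r : ℤ, (Finset.univ.filter fun i => y i % l = r % l).card =
          (Finset.univ.filter fun i => z i % l = r % l).card) := by
  constructor
  · intro h
    induction h with
    | refl => exact ⟨rfl, fun _ => rfl⟩
    | tail _ hmove ih =>
      exact ⟨hmove.sum_eq.trans ih.1, fun r => (ih.2 r).trans (hmove.card_filter_emod_eq _)⟩
  · rintro ⟨hsum, hcard⟩
    obtain ⟨σ, hσ⟩ := exists_perm_emod_eq hcard
    have hdvd (i : Fin k) : ∃ t, z i - y (σ i) = t * l :=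
      (Int.ModEq.dvd (hσ i).symm).imp fun _ ht => ht.trans (mul_comm _ _)
    choose t ht using hdvd
    have hz : z = y ∘ σ + fun i => t i * l := by
      ext i
      simp [← ht]
    have ht0 : ∑ i, t i = 0 := by
      have hmul : (∑ i, t i) * l = 0 := by
        simp [Finset.sum_mul, ← ht, Finset.sum_sub_distrib, hsum, Equiv.sum_comp σ y]
      exact (mul_eq_zero.1 hmul).resolve_right (by lia)
    rw [hz]
    exact (ReflMove.reflTransGen_comp_perm σ y).trans (ReflMove.mul_mem_translations ht0 _)
end

section
/- Fix integers k ≥ 1, l ≥ 1 and n ≥ 0. Let p and p̃ be increasing lattice paths of length n in ℤ^k with p(0) = p̃(0). Call p and p̃ l-equivalent if for every 1 ≤ j ≤ n the new value of p at step j is congruent modulo l to the new value of p̃ at step j. Define a tail-reflection move p → p′ as follows: there exist 0 ≤ i ≤ n, indices a ≠ b, and m ∈ ℤ with p(i)_a − p(i)_b = m·l, such that p′(u) = p(u) for all u ≤ i and p′(u) = s(p(u)) for all u > i, where s : ℤ^k → ℤ^k is the affine reflection given by s(v)_a = v_b + m·l, s(v)_b = v_a − m·l, s(v)_c = v_c for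 c ∉ {a,b}. Then p and p̃ are l-equivalent if and only if p̃ can be obtained from p by a finite sequence of tail-reflection moves. -/
/-- The `a`-th standard basis vector of `ℤ^k`. -/
def stepVec (k : ℕ) (a : Fin k) : Fin k → ℤ := fun c => if c = a then 1 else 0

/-- An increasing lattice path of length `n` in `ℤ^k`: at each step one coordinate is
incremented by `1`. -/
def IsLatticePath {k n : ℕ} (p : Fin (n + 1) → Fin k → ℤ) : Prop :=
  ∀ j : Fin n, ∃ a : Fin k, p j.succ = p j.castSucc + stepVec k a

/-- Two paths are `l`-equivalent if at every step the newly reached coordinate values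
are congruent modulo `l`. -/
def LEquiv {k n : ℕ} (l : ℤ) (p p' : Fin (n + 1) → Fin k → ℤ) : Prop :=
  ∀ j : Fin n, ∀ a b : Fin k,
    p j.succ = p j.castSucc + stepVec k a →
    p' j.succ = p' j.castSucc + stepVec k b →
    p j.succ a ≡ p' j.succ b [ZMOD l]

/-- A tail-reflection move: if `p(i)` lies on the hyperplane `v_a - v_b = m·l`, then
reflect the part of the path after `p(i)` in that hyperplane. -/
def TailMove {k n : ℕ} (l : ℤ) (p p' : Fin (n + 1) → Fin k → ℤ) : Prop :=
  ∃ (i : Fin (n + 1)) (a b : Fin k) (m : ℤ), a ≠ b ∧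
    p i a - p i b = m * l ∧
    (∀ u : Fin (n + 1), u ≤ i → p' u = p u) ∧
    (∀ u : Fin (n + 1), i < u →
      p' u a = p u b + m * l ∧ p' u b = p u a - m * l ∧
        ∀ c : Fin k, c ≠ a → c ≠ b → p' u c = p u c)

theorem stepVec_injective (k : ℕ) : Function.Injective (stepVec k) := by
  intro a b h
  have := congrFun h a
  by_contra hab
  simp [stepVec, hab] at this

/-- The affine reflection of `ℤ^k` in the hyperplane `v_a - v_b = t`. -/
def affineReflection {k : ℕ} (a b : Fin k) (t : ℤ) (v : Fin k → ℤ) : Fin k → ℤ :=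
  fun c => if c = a then v b + t else if c = b then v a - t else v c

theorem affineReflection_eq_self {k : ℕ} {a b : Fin k} {t : ℤ} {v : Fin k → ℤ}
    (h : v a - v b = t) : affineReflection a b t v = v := by
  funext c
  unfold affineReflection
  split_ifs with h₁ h₂ <;> subst_vars <;> ring

theorem affineReflection_add_stepVec {k : ℕ} {a b : Fin k} (hab : a ≠ b) (t : ℤ)
    (v : Fin k → ℤ) (c : Fin k) :
    affineReflection a b t (v + stepVec k c) =
      affineReflection a b t v + stepVec k (Equiv.swap a b c) := by
  funext d
  simp only [affineReflection, stepVec, Pi.add_apply, Equiv.swap_apply_def]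
  grind

theorem affineReflection_swap_modEq {k : ℕ} {a b : Fin k} (hab : a ≠ b) {l t : ℤ}
    (ht : l ∣ t) (v : Fin k → ℤ) (c : Fin k) :
    v c ≡ affineReflection a b t v (Equiv.swap a b c) [ZMOD l] := by
  rw [Int.modEq_iff_dvd]
  have ht' := dvd_neg.mpr ht
  simp only [affineReflection, Equiv.swap_apply_def]
  split_ifs <;> simp_all

/-- A tail move carries each step to a step whose new value is congruent. -/
theorem TailMove.exists_step {k n : ℕ} {l : ℤ} {p p' : Fin (n + 1) → Fin k → ℤ}
    (h : TailMove l p p') (j : Fin n) (c : Fin k)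
    (hc : p j.succ = p j.castSucc + stepVec k c) :
    ∃ d, p' j.succ = p' j.castSucc + stepVec k d ∧ p j.succ c ≡ p' j.succ d [ZMOD l] := by
  obtain ⟨i, a, b, m, hab, hi, hle, hlt⟩ := h
  have hrefl : ∀ u, i ≤ u → p' u = affineReflection a b (m * l) (p u) := by
    intro u hu
    rcases hu.eq_or_lt with rfl | hu
    · rw [affineReflection_eq_self hi, hle i le_rfl]
    · obtain ⟨h₁, h₂, h₃⟩ := hlt u hu
      funext d
      unfold affineReflection
      split_ifs with ha hb
      · rw [ha, h₁]
      · rw [hb, h₂]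
      · exact h₃ d ha hb
  by_cases hj : j.succ ≤ i
  · have hj' : j.castSucc ≤ i := (Fin.castSucc_lt_succ (i := j)).le.trans hj
    refine ⟨c, ?_, ?_⟩
    · rw [hle _ hj, hle _ hj', hc]
    · rw [hle _ hj]
  · have hj₁ : i ≤ j.succ := (not_le.mp hj).le
    have hj₂ : i ≤ j.castSucc := by
      rw [Fin.le_def]
      rw [Fin.le_def, Fin.val_succ] at hj
      simp only [Fin.val_castSucc]
      omega
    refine ⟨Equiv.swap a b c, ?_, ?_⟩
    · rw [hrefl _ hj₁, hrefl _ hj₂, hc, affineReflection_add_stepVec hab]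
    · rw [hrefl _ hj₁]
      exact affineReflection_swap_modEq hab (Dvd.intro_left m rfl) _ c

theorem TailMove.isLatticePath {k n : ℕ} {l : ℤ} {p p' : Fin (n + 1) → Fin k → ℤ}
    (h : TailMove l p p') (hp : IsLatticePath p) : IsLatticePath p' := fun j =>
  let ⟨c, hc⟩ := hp j
  let ⟨d, hd, _⟩ := h.exists_step j c hc
  ⟨d, hd⟩

theorem TailMove.lEquiv {k n : ℕ} {l : ℤ} {p p' : Fin (n + 1) → Fin k → ℤ}
    (h : TailMove l p p') : LEquiv l p p' := by
  intro j a b ha hb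
  obtain ⟨d, hd, hmod⟩ := h.exists_step j a ha
  obtain rfl : d = b := stepVec_injective k (add_left_cancel (hd.symm.trans hb))
  exact hmod

theorem LEquiv.refl {k n : ℕ} (l : ℤ) (p : Fin (n + 1) → Fin k → ℤ) : LEquiv l p p := by
  intro j a b ha hb
  obtain rfl : a = b := stepVec_injective k (add_left_cancel (ha.symm.trans hb))
  rfl

theorem LEquiv.symm {k n : ℕ} {l : ℤ} {p p' : Fin (n + 1) → Fin k → ℤ}
    (h : LEquiv l p p') : LEquiv l p' p :=
  fun j a b ha hb => (h j b a hb ha).symm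

theorem LEquiv.trans {k n : ℕ} {l : ℤ} {p q r : Fin (n + 1) → Fin k → ℤ}
    (hq : IsLatticePath q) (hpq : LEquiv l p q) (hqr : LEquiv l q r) : LEquiv l p r := by
  intro j a b ha hb
  obtain ⟨c, hc⟩ := hq j
  exact (hpq j a c ha hc).trans (hqr j c b hc hb)

theorem isLatticePath_and_lEquiv_of_reflTransGen {k n : ℕ} {l : ℤ}
    {p p' : Fin (n + 1) → Fin k → ℤ} (hp : IsLatticePath p)
    (h : Relation.ReflTransGen (TailMove l) p p') : IsLatticePath p' ∧ LEquiv l p p' := by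
  induction h with
  | refl => exact ⟨hp, LEquiv.refl l p⟩
  | tail _ hmove ih => exact ⟨hmove.isLatticePath ih.1, ih.2.trans ih.1 hmove.lEquiv⟩

/-- The path obtained by reflecting the part of `p` after time `i` in `v_a - v_b = t`. -/
def reflectTail {k n : ℕ} (i : Fin (n + 1)) (a b : Fin k) (t : ℤ)
    (p : Fin (n + 1) → Fin k → ℤ) : Fin (n + 1) → Fin k → ℤ :=
  fun u => if u ≤ i then p u else affineReflection a b t (p u)

theorem tailMove_reflectTail {k n : ℕ} {l m : ℤ} {p : Fin (n + 1) → Fin k → ℤ}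
    {i : Fin (n + 1)} {a b : Fin k} (hab : a ≠ b) (h : p i a - p i b = m * l) :
    TailMove l p (reflectTail i a b (m * l) p) := by
  refine ⟨i, a, b, m, hab, h, fun u hu => if_pos hu, fun u hu => ?_⟩
  simp only [reflectTail, if_neg hu.not_ge, affineReflection]
  refine ⟨if_pos trivial, ?_, fun c hca hcb => ?_⟩
  · rw [if_neg hab.symm, if_pos trivial]
  · rw [if_neg hca, if_neg hcb]

/-- `l`-equivalent paths that agree up to time `j` agree up to time `j + 1` after at most
one tail move. -/
theorem LEquiv.exists_agree_succ {k n : ℕ} {l : ℤ} {p p' : Fin (n + 1) → Fin k → ℤ}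
    (hp : IsLatticePath p) (hp' : IsLatticePath p') (h : LEquiv l p p') (j : Fin n)
    (hagree : ∀ u ≤ j.castSucc, p u = p' u) :
    ∃ q, Relation.ReflTransGen (TailMove l) p q ∧ ∀ u ≤ j.succ, q u = p' u := by
  obtain ⟨a, ha⟩ := hp j
  obtain ⟨b, hb⟩ := hp' j
  have hj := hagree _ le_rfl
  have extend : ∀ q : Fin (n + 1) → Fin k → ℤ, (∀ u ≤ j.castSucc, q u = p u) →
      q j.succ = p' j.succ → ∀ u ≤ j.succ, q u = p' u := by
    intro q hq hq' u hu
    rcases hu.eq_or_lt with rfl | hu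
    · exact hq'
    · have hu' : u ≤ j.castSucc := Fin.le_castSucc_iff.mpr hu
      rw [hq u hu', hagree u hu']
  by_cases hab : a = b
  · subst hab
    exact ⟨p, .refl, extend p (fun _ _ => rfl) (by rw [ha, hb, hj])⟩
  · obtain ⟨m, hm⟩ : ∃ m, p j.castSucc a - p j.castSucc b = m * l := by
      have hdvd := (h j a b ha hb).symm.dvd
      rw [ha, hb, ← hj] at hdvd
      obtain ⟨m, hm⟩ := hdvd
      refine ⟨m, ?_⟩
      simp only [stepVec, Pi.add_apply, if_true] at hm
      linarith
    refine ⟨_, .single (tailMove_reflectTail hab hm),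
      extend _ (fun u hu => if_pos hu) ?_⟩
    rw [reflectTail, if_neg (Fin.castSucc_lt_succ (i := j)).not_ge, ha,
      affineReflection_add_stepVec hab, affineReflection_eq_self hm, Equiv.swap_apply_left,
      hb, hj]

theorem LEquiv.reflTransGen {k n : ℕ} {l : ℤ} {p p' : Fin (n + 1) → Fin k → ℤ}
    (hp : IsLatticePath p) (hp' : IsLatticePath p') (h0 : p 0 = p' 0) (h : LEquiv l p p') :
    Relation.ReflTransGen (TailMove l) p p' := by
  have key : ∀ i : Fin (n + 1),
      ∃ q, Relation.ReflTransGen (TailMove l) p q ∧ ∀ u ≤ i, q u = p' u := by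
    intro i
    induction i using Fin.induction with
    | zero =>
      refine ⟨p, .refl, fun u hu => ?_⟩
      rw [Fin.le_zero_iff.mp hu, h0]
    | succ j ih =>
      obtain ⟨q, hpq, hq⟩ := ih
      obtain ⟨hql, hqe⟩ := isLatticePath_and_lEquiv_of_reflTransGen hp hpq
      obtain ⟨r, hqr, hr⟩ := (hqe.symm.trans hp h).exists_agree_succ hql hp' j hq
      exact ⟨r, hpq.trans hqr, hr⟩
  obtain ⟨q, hpq, hq⟩ := key (Fin.last n)
  rwa [funext fun u => hq u (Fin.le_last u)] at hpq

/-- Two increasing lattice paths of length `n` with the same starting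
point are `l`-equivalent if and only if one can be obtained from the other by a finite
sequence of tail-reflection moves. -/
theorem stmt_10 (k l n : ℕ) (hk : 1 ≤ k) (hl : 1 ≤ l)
    (p p' : Fin (n + 1) → Fin k → ℤ)
    (hp : IsLatticePath p) (hp' : IsLatticePath p')
    (h0 : p 0 = p' 0) :
    LEquiv (l : ℤ) p p' ↔ Relation.ReflTransGen (TailMove (l : ℤ)) p p' :=
  ⟨fun h => h.reflTransGen hp hp' h0,
    fun h => (isLatticePath_and_lEquiv_of_reflTransGen hp h).2⟩
end

section
/- Fix integers k ≥ 1 and l ≥ 1, and let y ∈ ℤ^k satisfy y_i − y_{i+1} ≥ l for all 1 ≤ i ≤ k−1 (y is an interior point). Define r_k = 0 and, for 1 ≤ i ≤ k−1, let r_i ∈ {0,1,…,l−1} be the residue of y_i − y_{i+1} modulo l; define c ∈ ℤ^k by c_i = y_i − Σ_{j=i}^{k} r_j. Then: (a) c_i − c_{i+1} ≥ l for all 1 ≤ i ≤ k−1, and l divides c_i − c_j for all i, j (so c is an interior k-critical point); (b) y − c = Σ_{i=1}^{k−1} r_i · e^{(i)}, where e^{(i)} ∈ ℤ^k is the vector whose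 first i coordinates are 1 and whose remaining coordinates are 0, and Σ_{i=1}^{k} (y_i − c_i) = Σ_{i=1}^{k−1} i·r_i ≤ (l−1)·k·(k−1)/2. -/
theorem Fin.sum_filter_le_eq_add {M : Type*} [AddCommMonoid M] {k : ℕ} (r : Fin k → M) (i : ℕ)
    (h : i + 1 < k) :
    ∑ j ∈ Finset.univ.filter (fun j : Fin k => ⟨i, by omega⟩ ≤ j), r j =
      r ⟨i, by omega⟩ + ∑ j ∈ Finset.univ.filter (fun j : Fin k => ⟨i + 1, h⟩ ≤ j), r j := by
  rw [← Finset.sum_insert (by simp [Fin.le_def])]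
  congr 1
  ext j
  simp only [Finset.mem_filter, Finset.mem_univ, true_and, Finset.mem_insert, Fin.le_def,
    Fin.ext_iff]
  omega

theorem Fin.sum_sum_filter_le {k : ℕ} (r : Fin k → ℤ) :
    ∑ i, ∑ j ∈ Finset.univ.filter (fun j : Fin k => i ≤ j), r j =
      ∑ i : Fin k, ((i : ℕ) + 1 : ℤ) * r i := by
  simp_rw [Finset.sum_filter]
  rw [Finset.sum_comm]
  refine Finset.sum_congr rfl fun j _ => ?_
  rw [← Finset.sum_filter, Finset.sum_const, Finset.filter_ge_eq_Iic, Fin.card_Iic, nsmul_eq_mul]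
  push_cast
  rfl

theorem Fin.sum_val_add_one_mul_two (m : ℕ) :
    (∑ i : Fin m, ((i : ℕ) + 1 : ℤ)) * 2 = m * (m + 1) := by
  induction m with
  | zero => simp
  | succ m ih =>
    rw [Fin.sum_univ_castSucc, add_mul]
    simp only [Fin.val_castSucc, Fin.val_last]
    rw [ih]
    push_cast
    ring

theorem Fin.sum_val_add_one_mul_le {k : ℕ} (hk : 1 ≤ k) {b : ℤ} (r : Fin k → ℤ)
    (hb : ∀ i, r i ≤ b) (hlast : ∀ i : Fin k, ¬ (i : ℕ) + 1 < k → r i = 0) :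
    ∑ i : Fin k, ((i : ℕ) + 1 : ℤ) * r i ≤ b * k * ((k : ℤ) - 1) / 2 := by
  obtain ⟨m, rfl⟩ := Nat.exists_eq_add_of_le' hk
  rw [Int.le_ediv_iff_mul_le two_pos, Fin.sum_univ_castSucc, hlast (Fin.last m) (by simp)]
  have hsum : ∑ i : Fin m, (((i.castSucc : Fin (m + 1)) : ℕ) + 1 : ℤ) * r i.castSucc ≤
      (∑ i : Fin m, ((i : ℕ) + 1 : ℤ)) * b := by
    rw [Finset.sum_mul]
    exact Finset.sum_le_sum fun i _ => mul_le_mul_of_nonneg_left (hb _) (by positivity)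
  have hm := congrArg (· * b) (Fin.sum_val_add_one_mul_two m)
  push_cast at *
  linarith


/-- Let `y ∈ ℤ^k` be an interior point (`y_i - y_{i+1} ≥ l`), let
`r_i` be the residue of `y_i - y_{i+1}` mod `l` (`r_k = 0`), and let
`c_i = y_i - ∑_{j ≥ i} r_j` be the associated critical point. Then (a) `c` is an
interior `k`-critical point; (b) `y - c = ∑ r_i · e^{(i)}`, where `e^{(i)}` has first
`i` coordinates `1` and the rest `0` (so its `a`-th coordinate is `1` iff `a ≤ i`),
and `∑ (y_i - c_i) = ∑ i·r_i ≤ (l-1)·k·(k-1)/2`. -/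
theorem stmt_14 (k l : ℕ) (hk : 1 ≤ k) (hl : 1 ≤ l)
    (y : Fin k → ℤ)
    (hint : ∀ (i : ℕ) (h : i + 1 < k), y ⟨i, by omega⟩ - y ⟨i + 1, h⟩ ≥ (l : ℤ))
    (r : Fin k → ℤ)
    (hr : ∀ i : Fin k, r i =
      if h : (i : ℕ) + 1 < k then (y i - y ⟨(i : ℕ) + 1, h⟩) % (l : ℤ) else 0)
    (c : Fin k → ℤ)
    (hc : ∀ i : Fin k, c i = y i - ∑ j ∈ Finset.univ.filter (fun j : Fin k => i ≤ j), r j) :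
    (∀ (i : ℕ) (h : i + 1 < k), c ⟨i, by omega⟩ - c ⟨i + 1, h⟩ ≥ (l : ℤ)) ∧
    (∀ i j : Fin k, (l : ℤ) ∣ (c i - c j)) ∧
    (∀ a : Fin k, y a - c a = ∑ i : Fin k, r i * (if a ≤ i then 1 else 0)) ∧
    (∑ i : Fin k, (y i - c i)) = (∑ i : Fin k, ((i : ℕ) + 1 : ℤ) * r i) ∧
    (∑ i : Fin k, ((i : ℕ) + 1 : ℤ) * r i) ≤ ((l : ℤ) - 1) * k * ((k : ℤ) - 1) / 2 := by
  have hl0 : (0 : ℤ) < l := by exact_mod_cast hl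
  have hstep : ∀ (i : ℕ) (h : i + 1 < k), c ⟨i, by omega⟩ - c ⟨i + 1, h⟩ =
      l * ((y ⟨i, by omega⟩ - y ⟨i + 1, h⟩) / l) := by
    intro i h
    have hri := hr ⟨i, by omega⟩
    simp only [h, dite_true] at hri
    rw [hc, hc, Fin.sum_filter_le_eq_add r i h, hri]
    linarith [Int.emod_add_mul_ediv (y ⟨i, by omega⟩ - y ⟨i + 1, h⟩) l]
  have hdvd : ∀ (n : ℕ) (h : n < k), (l : ℤ) ∣ c ⟨0, by omega⟩ - c ⟨n, h⟩ := by
    intro n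
    induction n with
    | zero => simp
    | succ n ih =>
      intro h
      rw [← sub_add_sub_cancel _ (c ⟨n, by omega⟩)]
      exact dvd_add (ih _) (hstep n h ▸ dvd_mul_right _ _)
  have hyc : ∀ i, y i - c i = ∑ j ∈ Finset.univ.filter (fun j : Fin k => i ≤ j), r j :=
    fun i => by rw [hc, sub_sub_cancel]
  refine ⟨fun i h => ?_, fun i j => ?_, fun a => ?_, ?_, ?_⟩
  · rw [hstep i h]
    exact le_mul_of_one_le_right hl0.le
      ((Int.le_ediv_iff_mul_le hl0).2 (by linarith [hint i h]))
  · rw [← sub_sub_sub_cancel_left _ _ (c ⟨0, by omega⟩)]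
    exact dvd_sub (hdvd j j.2) (hdvd i i.2)
  · simp [hyc, Finset.sum_filter]
  · simp_rw [hyc]
    exact Fin.sum_sum_filter_le r
  · refine Fin.sum_val_add_one_mul_le hk r (fun i => ?_) fun i hi => by simp [hr, hi]
    rw [hr]
    split_ifs
    · exact Int.le_sub_one_of_lt (Int.emod_lt_of_pos _ hl0)
    · omega
end

section
/- Let K be a field of characteristic 0 and let k ≥ 2, l ≥ 2, m ≥ 1 be integers; set n = m·l + (l−1)·k(k−1)/2. Let F = K(x) be the field of rational functions over K, let V = F^k, let A be the unital F-subalgebra of End_F(V^{⊗n}) generated by the operators R_1(x), …, R_{n−1}(x), and let B be the unital F-subalgebra of End_F(V^{⊗m}) generated by the operators R_1(x^l), …, R_{m−1}(x^l). Then there exists an injective F-linear map φ : B → A satisfying φ(b·b') = φ(b)·φ(b') for all b, b' ∈ B; that is, A contains a (non-unital) F-subalgebra isomorphic to B. (A is the k-row quotient of the Iwahori–Hecke algebra H_n with parameter x, and B is the k-row quotient of H_m with parameter x^l.) -/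
set_option maxHeartbeats 1000000
set_option synthInstance.maxHeartbeats 1000000

/-- Swap the values of `f : Fin n → Fin k` at the two positions `s` and `t`. -/
def swapAt (k n : ℕ) (s t : Fin n) (f : Fin n → Fin k) : Fin n → Fin k :=
  fun u => if u = s then f t else if u = t then f s else f u

/-- The matrix (in the standard basis of `V^{⊗n}`, `V = F^k`, with basis vectors
indexed by functions `Fin n → Fin k`) of the operator acting as Jimbo's `R`-matrix
with parameter `u` on the tensor factors in positions `s` and `t` and as the identity
elsewhere: `R(u)(ε_i ⊗ ε_j) = ε_j ⊗ ε_i` if `i < j`, `= u·ε_i ⊗ ε_i` if `i = j`, and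
`= (u-1)·ε_i ⊗ ε_j + u·ε_j ⊗ ε_i` if `i > j`. -/
def RMat (F : Type*) [Field F] (u : F) (k n : ℕ) (s t : Fin n) :
    Matrix (Fin n → Fin k) (Fin n → Fin k) F :=
  Matrix.of fun g f =>
    if f s = f t then (if g = f then u else 0)
    else if (f s : ℕ) < (f t : ℕ) then (if g = swapAt k n s t f then 1 else 0)
    else (if g = f then u - 1 else if g = swapAt k n s t f then u else 0)

/-- The operators `R_1(u), …, R_{n-1}(u)` on `V^{⊗n}`. -/
def HeckeGens (F : Type*) [Field F] (u : F) (k n : ℕ) :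
    Set (Module.End F ((Fin n → Fin k) → F)) :=
  {T | ∃ (s : ℕ) (h : s + 1 < n),
    T = (RMat F u k n ⟨s, Nat.lt_of_succ_lt h⟩ ⟨s + 1, h⟩).mulVecLin}

/-- The `k`-row quotient of the Iwahori–Hecke algebra `H_n(u)`: the unital subalgebra
of `End_F(V^{⊗n})` generated by the operators `R_1(u), …, R_{n-1}(u)`. -/
def RowQuotient (F : Type*) [Field F] (u : F) (k n : ℕ) :
    Subalgebra F (Module.End F ((Fin n → Fin k) → F)) :=
  Algebra.adjoin F (HeckeGens F u k n)

section RowQuotientTransport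

open Polynomial

section Spectral

variable {F A : Type*} [Field F] [Ring A] [Algebra F A]

/-- The product of the linear polynomials `X - c`, `c ∈ E`. -/
noncomputable def rootsPoly (E : Finset F) : F[X] := ∏ c ∈ E, (X - C c)

lemma X_sub_C_dvd_rootsPoly {E : Finset F} {c : F} (hc : c ∈ E) : X - C c ∣ rootsPoly E :=
  Finset.dvd_prod_of_mem _ hc

/-- An element annihilated by a split separable polynomial has a complete family of
spectral idempotents, which are polynomials in that element. -/
theorem exists_spectral_idempotents {E : Finset F} {L : A} (hL : aeval L (rootsPoly E) = 0) :
    ∃ q : F → F[X], (∑ c ∈ E, aeval L (q c) = 1) ∧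
      (∀ c, L * aeval L (q c) = c • aeval L (q c)) ∧
      (∀ c, aeval L (q c) * aeval L (q c) = aeval L (q c)) ∧
      (∀ c, ∃ r : F[X], (L - algebraMap F A c) * aeval L r = 1 - aeval L (q c)) := by
  classical
  rcases E.eq_empty_or_nonempty with rfl | hE
  · have h1 : (1 : A) = 0 := by simpa [rootsPoly] using hL
    have : Subsingleton A := subsingleton_of_zero_eq_one h1.symm
    exact ⟨fun _ => 0, Subsingleton.elim _ _, fun _ => Subsingleton.elim _ _,
      fun _ => Subsingleton.elim _ _, fun _ => ⟨0, Subsingleton.elim _ _⟩⟩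
  have hinj : Set.InjOn (id : F → F) E := Function.injective_id.injOn
  have hmul : ∀ c ∈ E, L * aeval L (Lagrange.basis E id c)
      = c • aeval L (Lagrange.basis E id c) := by
    intro c hc
    have h1 : (X - C c) * Lagrange.basis E id c
        = (∏ d ∈ E.erase c, C ((c - d)⁻¹)) * rootsPoly E := by
      unfold Lagrange.basis rootsPoly
      rw [← Finset.mul_prod_erase E _ hc]
      simp only [Lagrange.basisDivisor, Finset.prod_mul_distrib, id]
      ring
    have h2 := congrArg (aeval L) h1
    rw [map_mul, map_mul, hL, mul_zero] at h2
    simpa [sub_mul, sub_eq_zero, Algebra.smul_def] using h2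
  let q : F → F[X] := fun c => if c ∈ E then Lagrange.basis E id c else 0
  have hq : ∀ c, q c = if c ∈ E then Lagrange.basis E id c else 0 := fun _ => rfl
  refine ⟨q, ?_, fun c => ?_, fun c => ?_,
    fun c => ?_⟩
  · rw [Finset.sum_congr rfl fun c hc => by rw [hq, if_pos hc], ← map_sum,
      Lagrange.sum_basis hinj hE, map_one]
  · rw [hq]
    split_ifs with hc
    · exact hmul c hc
    · simp
  · rw [hq]
    split_ifs with hc
    · have key : ∀ g : F[X], aeval L g * aeval L (Lagrange.basis E id c)
          = g.eval c • aeval L (Lagrange.basis E id c) := by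
        intro g
        induction g using Polynomial.induction_on' with
        | add p q hp hq => simp [add_mul, hp, hq, add_smul]
        | monomial n a =>
          induction n with
          | zero => simp [Algebra.smul_def]
          | succ n ih =>
            have : monomial (n + 1) a = monomial n a * X := by simp
            rw [this, map_mul, mul_assoc, aeval_X, hmul c hc, mul_smul_comm, ih, smul_smul]
            congr 1
            simp only [eval_monomial, eval_mul, eval_X]
            ring
      have : (Lagrange.basis E id c).eval c = 1 := Lagrange.eval_basis_self hinj hc
      rw [key, this, one_smul]
    · simp
  · rw [hq]
    split_ifs with hc
    · have : (Lagrange.basis E id c).eval c = 1 := Lagrange.eval_basis_self hinj hc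
      obtain ⟨r, hr⟩ : X - C c ∣ 1 - Lagrange.basis E id c := by
        rw [dvd_iff_isRoot]; simp [this]
      exact ⟨r, by simpa using (congrArg (aeval L) hr).symm⟩
    · have hne : (rootsPoly E).eval c ≠ 0 := by
        rw [rootsPoly, eval_prod, Finset.prod_ne_zero_iff]
        intro d hd
        simp only [eval_sub, eval_X, eval_C, sub_ne_zero]
        rintro rfl
        exact hc hd
      obtain ⟨r, hr⟩ : X - C c ∣ 1 - C ((rootsPoly E).eval c)⁻¹ * rootsPoly E := by
        rw [dvd_iff_isRoot]; simp [hne]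
      refine ⟨r, ?_⟩
      have := congrArg (aeval L) hr
      rw [map_sub, map_mul, map_mul, hL] at this
      simpa using this.symm

end Spectral

section JucysMurphy

variable {F A : Type*} [Field F] [Ring A] [Algebra F A]

/-- The defining relations of the Iwahori-Hecke algebra with generators `T 0, …, T (N - 1)`. -/
structure HeckeRel (u : F) (N : ℕ) (T : ℕ → A) : Prop where
  quad : ∀ s < N, T s * T s = (u - 1) • T s + u • (1 : A)
  braid : ∀ s, s + 1 < N → T s * T (s + 1) * T s = T (s + 1) * T s * T (s + 1)
  far : ∀ s t, s + 1 < t → t < N → Commute (T s) (T t)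

/-- Multiplicative Jucys-Murphy elements. -/
def jucysMurphy (u : F) (T : ℕ → A) : ℕ → A
  | 0 => 1
  | j + 1 => u⁻¹ • (T j * jucysMurphy u T j * T j)

/-- The subalgebra generated by `T 0, …, T (j - 1)`. -/
def parabolic (F : Type*) {A : Type*} [Field F] [Ring A] [Algebra F A] (T : ℕ → A) (j : ℕ) :
    Subalgebra F A :=
  Algebra.adjoin F (T '' {s | s < j})

lemma parabolic_mono (T : ℕ → A) {i j : ℕ} (h : i ≤ j) : parabolic F T i ≤ parabolic F T j :=
  Algebra.adjoin_mono (Set.image_mono fun _ hs => lt_of_lt_of_le hs h)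

lemma gen_mem_parabolic (T : ℕ → A) {s j : ℕ} (h : s < j) : T s ∈ parabolic F T j :=
  Algebra.subset_adjoin ⟨s, h, rfl⟩

lemma jucysMurphy_mem (u : F) (T : ℕ → A) (j : ℕ) : jucysMurphy u T j ∈ parabolic F T j := by
  induction j with
  | zero => exact one_mem _
  | succ j ih =>
    exact Subalgebra.smul_mem _ (mul_mem (mul_mem (gen_mem_parabolic T j.lt_succ_self)
      (parabolic_mono T j.le_succ ih)) (gen_mem_parabolic T j.lt_succ_self)) _

lemma commute_of_mem_parabolic {T : ℕ → A} {j : ℕ} {y : A} (h : ∀ s < j, Commute (T s) y)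
    {z : A} (hz : z ∈ parabolic F T j) : Commute z y := by
  induction hz using Algebra.adjoin_induction with
  | mem x hx => obtain ⟨s, hs, rfl⟩ := hx; exact h s hs
  | algebraMap r => exact Algebra.commutes r y
  | add _ _ _ _ h1 h2 => exact h1.add_left h2
  | mul _ _ _ _ h1 h2 => exact h1.mul_left h2

lemma aeval_mem_of_mem' {S : Subalgebra F A} {x : A} (hx : x ∈ S) (q : F[X]) : aeval x q ∈ S :=
  Algebra.adjoin_le (Set.singleton_subset_iff.2 hx) (aeval_mem_adjoin_singleton F x)

lemma map_aeval_of_map_eq_op (st : A →ₐ[F] Aᵐᵒᵖ) {x : A} (hx : st x = .op x) (q : F[X]) :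
    st (aeval x q) = .op (aeval x q) := by
  induction q using Polynomial.induction_on' with
  | add p q hp hq => simp [hp, hq]
  | monomial n a =>
    rw [aeval_monomial, map_mul, map_pow, hx, AlgHom.commutes, Algebra.commutes,
      MulOpposite.op_mul, MulOpposite.op_pow, MulOpposite.algebraMap_apply]

lemma Commute.aeval_right' {x y : A} (h : Commute x y) (q : F[X]) : Commute x (aeval y q) := by
  induction q using Polynomial.induction_on' with
  | add p q hp hq => rw [map_add]; exact hp.add_right hq
  | monomial n a =>
    rw [aeval_monomial]
    exact (show Commute x (algebraMap F A a) from (Algebra.commutes a x).symm).mul_right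
      (h.pow_right n)

/-- The sum of the double cosets of the identity and of `T j` with respect to the subalgebra
generated by the first `j` generators. -/
def doubleCoset (F : Type*) {A : Type*} [Field F] [Ring A] [Algebra F A] (T : ℕ → A) (j : ℕ) :
    Submodule F A :=
  Subalgebra.toSubmodule (parabolic F T j) ⊔ Submodule.span F
      {w | ∃ x ∈ parabolic F T j, ∃ y ∈ parabolic F T j, w = x * T j * y}

variable {u : F} {N : ℕ} {T : ℕ → A}

lemma mul_mem_doubleCoset {j : ℕ} {x y w : A} (hx : x ∈ parabolic F T j)
    (hy : y ∈ parabolic F T j)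
    (hw : w ∈ doubleCoset F T j) :
    x * w * y ∈ doubleCoset F T j := by
  obtain ⟨a, ha, b, hb, rfl⟩ := Submodule.mem_sup.1 hw
  rw [mul_add, add_mul]
  refine add_mem (Submodule.mem_sup_left (show x * a * y ∈ parabolic F T j from
    mul_mem (mul_mem hx ha) hy))
    (Submodule.mem_sup_right ?_)
  induction hb using Submodule.span_induction with
  | mem b hb =>
    obtain ⟨x', hx', y', hy', rfl⟩ := hb
    exact Submodule.subset_span ⟨x * x', mul_mem hx hx', y' * y, mul_mem hy' hy, by noncomm_ring⟩
  | zero => simp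
  | add b c _ _ hb hc =>
    rw [mul_add, add_mul]
    exact add_mem (hb (add_mem (Submodule.mem_sup_left ha) (Submodule.mem_sup_right ‹_›)))
      (hc (add_mem (Submodule.mem_sup_left ha) (Submodule.mem_sup_right ‹_›)))
  | smul r b _ hb =>
    rw [mul_smul_comm, smul_mul_assoc]
    exact Submodule.smul_mem _ _ (hb (add_mem (Submodule.mem_sup_left ha)
      (Submodule.mem_sup_right ‹_›)))

lemma mem_doubleCoset_of_mem_parabolic {j : ℕ}
    (h : ∀ x ∈ parabolic F T j, T j * x * T j ∈ doubleCoset F T j)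
    {z : A} (hz : z ∈ parabolic F T (j + 1)) :
    z ∈ doubleCoset F T j := by
  suffices h' : ∀ w ∈ doubleCoset F T j, z * w ∈ doubleCoset F T j by
    simpa using h' 1 (Submodule.mem_sup_left (one_mem (parabolic F T j)))
  induction hz using Algebra.adjoin_induction with
  | mem x hx =>
    obtain ⟨s, hs, rfl⟩ := hx
    intro w hw
    rcases Nat.lt_succ_iff_lt_or_eq.1 hs with hs | rfl
    · simpa using mul_mem_doubleCoset (gen_mem_parabolic T hs) (one_mem _) hw
    · obtain ⟨a, ha, b, hb, rfl⟩ := Submodule.mem_sup.1 hw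
      clear hw
      rw [mul_add]
      refine add_mem (Submodule.mem_sup_right (Submodule.subset_span
        ⟨1, one_mem _, a, ha, by simp⟩)) ?_
      induction hb using Submodule.span_induction with
      | mem b hb =>
        obtain ⟨x, hx, y, hy, rfl⟩ := hb
        have := mul_mem_doubleCoset (one_mem _) hy (h x hx)
        rw [one_mul] at this
        simpa only [mul_assoc] using this
      | zero => simp
      | add b c _ _ hb hc => rw [mul_add]; exact add_mem hb hc
      | smul r b _ hb => rw [mul_smul_comm]; exact Submodule.smul_mem _ _ hb
  | algebraMap r =>
    intro w hw
    rw [← Algebra.smul_def]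
    exact Submodule.smul_mem _ _ hw
  | add x y _ _ hx hy =>
    intro w hw
    rw [add_mul]
    exact add_mem (hx w hw) (hy w hw)
  | mul x y _ _ hx hy =>
    intro w hw
    rw [mul_assoc]
    exact hx _ (hy w hw)

variable (hT : HeckeRel u N T)
include hT

lemma HeckeRel.commute_high {j s : ℕ} (hj : j < s) (hs : s < N) :
    Commute (jucysMurphy u T j) (T s) := by
  refine commute_of_mem_parabolic (fun i hi => hT.far i s (by omega) hs) (jucysMurphy_mem u T j)

lemma HeckeRel.commute_low {j s : ℕ} (hs : s + 1 < j) (hj : j ≤ N) :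
    Commute (T s) (jucysMurphy u T j) := by
  induction j with
  | zero => omega
  | succ j ih =>
    refine Commute.smul_right ?_ _
    rcases Nat.lt_or_ge (s + 1) j with h | h
    · have h1 := hT.far s j h (by omega)
      exact (h1.mul_right (ih h (by omega))).mul_right h1
    · obtain rfl : j = s + 1 := by omega
      have hb := hT.braid s (by omega)
      have hc := hT.commute_high (j := s) (s := s + 1) (by omega) (by omega)
      change Commute (T s) (T (s + 1) * u⁻¹ • (T s * jucysMurphy u T s * T s) * T (s + 1))
      rw [mul_smul_comm, smul_mul_assoc]
      refine Commute.smul_right ?_ _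
      generalize jucysMurphy u T s = L at hc ⊢
      change _ = _
      calc T s * (T (s + 1) * (T s * L * T s) * T (s + 1))
          = (T s * T (s + 1) * T s) * L * T s * T (s + 1) := by noncomm_ring
        _ = T (s + 1) * T s * (T (s + 1) * L) * T s * T (s + 1) := by rw [hb]; noncomm_ring
        _ = T (s + 1) * T s * L * (T (s + 1) * T s * T (s + 1)) := by
            rw [← hc.eq]; noncomm_ring
        _ = _ := by rw [← hb]; noncomm_ring

/-- `L_{j+1}` centralizes the subalgebra generated by the first `j` generators. -/
lemma HeckeRel.commute_parabolic {j : ℕ} (hj : j + 1 ≤ N) {z : A} (hz : z ∈ parabolic F T j) :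
    Commute z (jucysMurphy u T (j + 1)) :=
  commute_of_mem_parabolic (fun _ hs => hT.commute_low (by omega) hj) hz

lemma HeckeRel.sq_mem_doubleCoset {j : ℕ} (hj : j < N) :
    T j * T j ∈ doubleCoset F T j := by
  rw [hT.quad j hj]
  exact add_mem
    (Submodule.smul_mem _ _ (Submodule.mem_sup_right (Submodule.subset_span
      ⟨1, one_mem _, 1, one_mem _, by simp⟩)))
    (Submodule.smul_mem _ _ (Submodule.mem_sup_left (one_mem (parabolic F T j))))

/-- The double coset decomposition of a parabolic subalgebra with respect to the preceding one. -/
theorem HeckeRel.parabolic_succ_le {j : ℕ} (hj : j < N) {z : A}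
    (hz : z ∈ parabolic F T (j + 1)) :
    z ∈ doubleCoset F T j := by
  induction j generalizing z with
  | zero =>
    refine mem_doubleCoset_of_mem_parabolic (fun x hx => ?_) hz
    obtain ⟨r, rfl⟩ : ∃ r, algebraMap F A r = x := by
      simpa [parabolic, Algebra.mem_bot] using hx
    rw [← Algebra.commutes, mul_assoc, ← Algebra.smul_def]
    exact Submodule.smul_mem _ _ (hT.sq_mem_doubleCoset hj)
  | succ j ih =>
    refine mem_doubleCoset_of_mem_parabolic (fun x hx => ?_) hz
    have hle := parabolic_mono (F := F) T j.le_succ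
    have hcomm : ∀ z ∈ parabolic F T j, Commute z (T (j + 1)) := fun z hz =>
      commute_of_mem_parabolic (fun s hs => hT.far s (j + 1) (by omega) hj) hz
    obtain ⟨a, ha, b, hb, rfl⟩ := Submodule.mem_sup.1 (ih (by omega) hx)
    rw [mul_add, add_mul]
    refine add_mem ?_ ?_
    · rw [← (hcomm a ha).eq, mul_assoc]
      simpa using mul_mem_doubleCoset (hle ha) (one_mem _) (hT.sq_mem_doubleCoset hj)
    · clear hx
      induction hb using Submodule.span_induction with
      | mem b hb =>
        obtain ⟨x, hx, y, hy, rfl⟩ := hb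
        refine Submodule.mem_sup_right (Submodule.subset_span
          ⟨x * T j, mul_mem (hle hx) (gen_mem_parabolic T j.lt_succ_self), T j * y,
            mul_mem (gen_mem_parabolic T j.lt_succ_self) (hle hy), ?_⟩)
        calc T (j + 1) * (x * T j * y) * T (j + 1)
            = (T (j + 1) * x) * T j * (y * T (j + 1)) := by noncomm_ring
          _ = x * (T (j + 1) * T j * T (j + 1)) * y := by
              rw [← (hcomm x hx).eq, (hcomm y hy).eq]; noncomm_ring
          _ = _ := by rw [← hT.braid j hj]; noncomm_ring
      | zero => simp
      | add b c _ _ hb hc =>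
        rw [mul_add, add_mul]
        exact add_mem hb hc
      | smul r b _ hb =>
        rw [mul_smul_comm, smul_mul_assoc]
        exact Submodule.smul_mem _ _ hb

lemma HeckeRel.gen_mul_jucysMurphy (hu : u ≠ 0) {j : ℕ} (hj : j < N) :
    T j * jucysMurphy u T j = jucysMurphy u T (j + 1) * (T j - (u - 1) • 1) := by
  have h : T j * (T j - (u - 1) • 1) = u • 1 := by
    rw [mul_sub, hT.quad j hj, mul_smul_comm, mul_one, add_sub_cancel_left]
  rw [jucysMurphy, smul_mul_assoc, mul_assoc, h, mul_smul_comm, mul_one, smul_smul,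
    inv_mul_cancel₀ hu, one_smul]

lemma HeckeRel.jucysMurphy_mul_gen (hu : u ≠ 0) {j : ℕ} (hj : j < N) :
    jucysMurphy u T j * T j = (T j - (u - 1) • 1) * jucysMurphy u T (j + 1) := by
  have h : (T j - (u - 1) • 1) * T j = u • 1 := by
    rw [sub_mul, hT.quad j hj, smul_mul_assoc, one_mul, add_sub_cancel_left]
  rw [jucysMurphy, mul_smul_comm, mul_assoc (T j), ← mul_assoc _ (T j), h, smul_mul_assoc, one_mul,
    smul_smul, inv_mul_cancel₀ hu, one_smul]

/-- A spectral idempotent of `L_{j+1}` compresses the subalgebra generated by the first `j + 1`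
generators to the one generated by the first `j` of them. -/
theorem HeckeRel.exists_compression (hu : u ≠ 0) (hu1 : u ≠ 1) {j : ℕ} (hj : j < N)
    {E : Finset F} (hE : aeval (jucysMurphy u T j) (rootsPoly E) = 0) {c : F} (hc : c ≠ 0)
    {Q : A} (hQ : ∀ z ∈ parabolic F T j, Commute z Q) (hQQ : Q * Q = Q)
    (hQL : Q * jucysMurphy u T (j + 1) = c • Q)
    {z : A} (hz : z ∈ parabolic F T (j + 1)) :
    ∃ z' ∈ parabolic F T j, Q * z * Q = z' * Q := by
  obtain ⟨q, -, hq, -, hr⟩ := exists_spectral_idempotents hE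
  obtain ⟨r, hr⟩ := hr c
  specialize hq c
  have hmem : ∀ g : F[X], aeval (jucysMurphy u T j) g ∈ parabolic F T j := fun g =>
    aeval_mem_of_mem' (jucysMurphy_mem u T j) g
  have hL := hQ _ (jucysMurphy_mem u T j)
  have hTL := hT.gen_mul_jucysMurphy hu hj
  set L := jucysMurphy u T j
  set L' := jucysMurphy u T (j + 1)
  have h1 : Q * T j * Q * (L - algebraMap F A c) = (-((u - 1) * c)) • Q := by
    have h2 : Q * T j * Q * L = c • (Q * T j * Q) - ((u - 1) * c) • Q := by
      calc Q * T j * Q * L = Q * (T j * L) * Q := by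
            rw [mul_assoc _ Q, ← hL.eq]; noncomm_ring
        _ = (Q * L') * (T j - (u - 1) • 1) * Q := by rw [hTL]; noncomm_ring
        _ = _ := by
            rw [hQL]
            simp only [smul_mul_assoc, mul_sub, sub_mul, mul_smul_comm, mul_one, hQQ, smul_smul]
    rw [mul_sub, h2, ← Algebra.commutes, ← Algebra.smul_def, neg_smul]
    abel
  have h3 : Q * aeval L (q c) = 0 := by
    have h4 : Q * T j * Q * (L - algebraMap F A c) * aeval L (q c) = 0 := by
      rw [mul_assoc, sub_mul, hq, ← Algebra.smul_def, sub_self, mul_zero]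
    rw [h1, smul_mul_assoc] at h4
    refine (smul_eq_zero.1 h4).resolve_left ?_
    exact neg_ne_zero.2 (mul_ne_zero (sub_ne_zero.2 hu1) hc)
  have h5 : Q * T j * Q = ((-((u - 1) * c)) • aeval L r) * Q := by
    calc Q * T j * Q = Q * T j * Q * ((L - algebraMap F A c) * aeval L r + aeval L (q c)) := by
          rw [hr]; simp
      _ = Q * T j * Q * (L - algebraMap F A c) * aeval L r + Q * T j * (Q * aeval L (q c)) := by
          noncomm_ring
      _ = _ := by
          rw [h1, h3, mul_zero, add_zero, smul_mul_assoc, smul_mul_assoc, (hQ _ (hmem r)).eq]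
  obtain ⟨a, ha, b, hb, rfl⟩ := Submodule.mem_sup.1 (hT.parabolic_succ_le hj hz)
  suffices h : ∃ z' ∈ parabolic F T j, Q * b * Q = z' * Q by
    obtain ⟨z', hz', h⟩ := h
    refine ⟨a + z', add_mem ha hz', ?_⟩
    rw [mul_add, add_mul, h, add_mul, ← (hQ a ha).eq, mul_assoc, hQQ]
  clear hz
  induction hb using Submodule.span_induction with
  | mem b hb =>
    obtain ⟨x, hx, y, hy, rfl⟩ := hb
    refine ⟨x * ((-((u - 1) * c)) • aeval L r) * y,
      mul_mem (mul_mem hx (Subalgebra.smul_mem _ (hmem r) _)) hy, ?_⟩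
    calc Q * (x * T j * y) * Q = (Q * x) * T j * (y * Q) := by noncomm_ring
      _ = x * (Q * T j * Q) * y := by rw [← (hQ x hx).eq, (hQ y hy).eq]; noncomm_ring
      _ = _ := by rw [h5, mul_assoc, mul_assoc, ← (hQ y hy).eq]; noncomm_ring
  | zero => exact ⟨0, zero_mem _, by simp⟩
  | add b c _ _ hb hc =>
    obtain ⟨x, hx, h⟩ := hb
    obtain ⟨y, hy, h'⟩ := hc
    exact ⟨x + y, add_mem hx hy, by rw [mul_add, add_mul, h, h', add_mul]⟩
  | smul r b _ hb =>
    obtain ⟨x, hx, h⟩ := hb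
    exact ⟨r • x, Subalgebra.smul_mem _ hx r, by
      rw [mul_smul_comm, smul_mul_assoc, h, smul_mul_assoc]⟩

/-- If the Jucys-Murphy elements are diagonalizable, every nonzero element is not annihilated
by some element `e` with `e Z e` one-dimensional. -/
theorem HeckeRel.exists_one_dim_corner (hu : u ≠ 0) (hu1 : u ≠ 1)
    (hd : ∀ j ≤ N, ∃ E : Finset F, 0 ∉ E ∧ aeval (jucysMurphy u T j) (rootsPoly E) = 0)
    {j : ℕ} (hj : j ≤ N) {x : A} (hx : x ≠ 0) :
    ∃ e ∈ parabolic F T j, e * x ≠ 0 ∧ ∀ z ∈ parabolic F T j, ∃ t : F, e * z * e = t • e := by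
  induction j with
  | zero =>
    refine ⟨1, one_mem _, by simpa using hx, fun z hz => ?_⟩
    obtain ⟨r, rfl⟩ : ∃ r, algebraMap F A r = z := by
      simpa [parabolic, Algebra.mem_bot] using hz
    exact ⟨r, by simp [Algebra.smul_def]⟩
  | succ j ih =>
    obtain ⟨e, he, hex, hez⟩ := ih (by omega)
    obtain ⟨E₀, -, hE₀⟩ := hd j (by omega)
    obtain ⟨E, hE0, hE⟩ := hd (j + 1) hj
    obtain ⟨q, hsum, hq, hqq, -⟩ := exists_spectral_idempotents hE
    obtain ⟨c, hc, hne⟩ : ∃ c ∈ E, aeval (jucysMurphy u T (j + 1)) (q c) * (e * x) ≠ 0 := by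
      by_contra! h
      apply hex
      rw [← one_mul (e * x), ← hsum, Finset.sum_mul, Finset.sum_eq_zero h]
    have hcomm : ∀ z ∈ parabolic F T j, Commute z (aeval (jucysMurphy u T (j + 1)) (q c)) :=
      fun z hz => (hT.commute_parabolic hj hz).aeval_right' _
    have hmem : aeval (jucysMurphy u T (j + 1)) (q c) ∈ parabolic F T (j + 1) :=
      aeval_mem_of_mem' (jucysMurphy_mem u T (j + 1)) _
    have hQL := hq c
    rw [((Commute.refl (jucysMurphy u T (j + 1))).aeval_right' _).eq] at hQL
    have hcomp := fun z (hz : z ∈ parabolic F T (j + 1)) =>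
      hT.exists_compression hu hu1 (by omega) hE₀ (c := c) (by rintro rfl; exact hE0 hc)
        hcomm (hqq c) hQL hz
    generalize aeval (jucysMurphy u T (j + 1)) (q c) = Q at *
    refine ⟨Q * e, mul_mem hmem (parabolic_mono T j.le_succ he), by rwa [mul_assoc],
      fun z hz => ?_⟩
    obtain ⟨z', hz', h⟩ := hcomp z hz
    obtain ⟨t, ht⟩ := hez z' hz'
    refine ⟨t, ?_⟩
    calc Q * e * z * (Q * e) = e * (Q * z * Q) * e := by
          nth_rewrite 1 [← (hcomm e he).eq]; noncomm_ring
      _ = (e * z' * e) * Q := by rw [h, mul_assoc _ e, (hcomm e he).eq]; noncomm_ring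
      _ = _ := by rw [ht, smul_mul_assoc, (hcomm e he).eq]

/-- The spectrum of `L_{j+1}` is controlled by that of `L_j`. -/
theorem HeckeRel.exists_spectrum_succ (hu : u ≠ 0) {j : ℕ} (hj : j < N)
    {E : Finset F} (hE0 : 0 ∉ E) (hE : aeval (jucysMurphy u T j) (rootsPoly E) = 0) :
    ∃ E' : Finset F, 0 ∉ E' ∧ aeval (jucysMurphy u T (j + 1)) (rootsPoly E') ^ 3 = 0 := by
  classical
  obtain ⟨q, hsum, hq, hqq, -⟩ := exists_spectral_idempotents hE
  have hpL : ∀ c, aeval (jucysMurphy u T j) (q c) * jucysMurphy u T j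
      = c • aeval (jucysMurphy u T j) (q c) := fun c => by
    rw [← ((Commute.refl (jucysMurphy u T j)).aeval_right' _).eq, hq]
  have hpL' : ∀ c, Commute (aeval (jucysMurphy u T j) (q c)) (jucysMurphy u T (j + 1)) :=
    fun c => hT.commute_parabolic hj (aeval_mem_of_mem' (jucysMurphy_mem u T j) _)
  have hLT := hT.jucysMurphy_mul_gen hu hj
  have hTT := hT.quad j hj
  generalize jucysMurphy u T j = L at *
  generalize jucysMurphy u T (j + 1) = L' at *
  generalize T j = t at *
  set p : F → A := fun c => aeval L (q c) with hp
  change ∑ c ∈ E, p c = 1 at hsum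
  change ∀ c, L * p c = c • p c at hq
  change ∀ c, p c * p c = p c at hqq
  change ∀ c, p c * L = c • p c at hpL
  change ∀ c, Commute (p c) L' at hpL'
  refine ⟨E ∪ E.image (fun a => u * a) ∪ E.image (fun a => u⁻¹ * a), ?_, ?_⟩
  · simp only [Finset.mem_union, Finset.mem_image, not_or, not_exists, not_and]
    have hne : ∀ x ∈ E, x ≠ 0 := fun x hx h => hE0 (h ▸ hx)
    exact ⟨⟨hE0, fun x hx => mul_ne_zero hu (hne x hx)⟩,
      fun x hx => mul_ne_zero (inv_ne_zero hu) (hne x hx)⟩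
  set E' := E ∪ E.image (fun a => u * a) ∪ E.image (fun a => u⁻¹ * a) with hE'
  rw [← map_pow, ← one_mul (aeval L' _), ← hsum, Finset.sum_mul]
  refine Finset.sum_eq_zero fun a ha => ?_
  obtain ⟨g, hg⟩ : (C ((u - 1) ^ 2) * X * X - C ((u - 1) ^ 2) * X * (X - C a)
      - C u * (X - C a) * (X - C a)) * rootsPoly E ∣ rootsPoly E' ^ 3 := by
    have h1 : (C ((u - 1) ^ 2) * X * X - C ((u - 1) ^ 2) * X * (X - C a)
      - C u * (X - C a) * (X - C a)) = C (-u) * ((X - C (u * a)) * (X - C (u⁻¹ * a))) := by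
      have : C u * C u⁻¹ = (1 : F[X]) := by rw [← C_mul, mul_inv_cancel₀ hu, C_1]
      simp only [C_mul, C_pow, C_sub, C_neg, C_1]
      linear_combination (C u * C a * C a - X * C a) * this
    rw [h1, mul_assoc, (isUnit_C.2 (neg_ne_zero.2 hu).isUnit).mul_left_dvd]
    have h2 : rootsPoly E ∣ rootsPoly E' :=
      Finset.prod_dvd_prod_of_subset _ _ _ (by intro x hx; simp [hE', hx])
    have h3 : X - C (u * a) ∣ rootsPoly E' := X_sub_C_dvd_rootsPoly (by
      simp only [hE', Finset.mem_union, Finset.mem_image]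
      exact Or.inl (Or.inr ⟨a, ha, rfl⟩))
    have h4 : X - C (u⁻¹ * a) ∣ rootsPoly E' := X_sub_C_dvd_rootsPoly (by
      simp only [hE', Finset.mem_union, Finset.mem_image]
      exact Or.inr ⟨a, ha, rfl⟩)
    rw [pow_succ, pow_two]
    exact mul_dvd_mul (mul_dvd_mul h3 h4) h2
  rw [hg, map_mul, ← mul_assoc]
  suffices h : p a * aeval L' ((C ((u - 1) ^ 2) * X * X - C ((u - 1) ^ 2) * X * (X - C a)
      - C u * (X - C a) * (X - C a)) * rootsPoly E) = 0 by rw [h, zero_mul]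
  have horth : ∀ b, b ≠ a → p b * p a = 0 := by
    intro b hb
    have h1 : b • (p b * p a) = a • (p b * p a) := by
      rw [← smul_mul_assoc, ← hpL, mul_assoc, hq, mul_smul_comm]
    rw [← sub_eq_zero, ← sub_smul] at h1
    exact (smul_eq_zero.1 h1).resolve_left (sub_ne_zero.2 hb)
  have hsand : ∀ b, b • (p b * t * p a) = p b * t * p a * L' - (u - 1) • (p b * p a * L') := by
    intro b
    calc b • (p b * t * p a) = p b * (L * t) * p a := by
          rw [← smul_mul_assoc, ← smul_mul_assoc, ← hpL]; noncomm_ring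
      _ = p b * (t - (u - 1) • 1) * (L' * p a) := by rw [hLT]; noncomm_ring
      _ = _ := by
          rw [← (hpL' a).eq]
          simp only [mul_sub, sub_mul, mul_smul_comm, smul_mul_assoc, mul_one]
          noncomm_ring
  set W := aeval L' (rootsPoly E) with hW
  have hoff : ∀ b ∈ E, b ≠ a → p b * t * p a * W = 0 := by
    intro b hb hba
    obtain ⟨h, hh⟩ := X_sub_C_dvd_rootsPoly hb
    have h1 := hsand b
    rw [horth b hba, zero_mul, smul_zero, sub_zero] at h1
    rw [hW, hh, map_mul, ← mul_assoc, map_sub, aeval_X, aeval_C, mul_sub, ← h1,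
      ← Algebra.commutes, ← Algebra.smul_def, sub_self, zero_mul]
  set x := p a * t * p a with hx
  have hxD : x * (L' - algebraMap F A a) = (u - 1) • (p a * L') := by
    have h1 := hsand a
    rw [hqq] at h1
    rw [mul_sub, ← Algebra.commutes, ← Algebra.smul_def, h1]
    abel
  have hxp : x * p a = x := by rw [hx, mul_assoc, hqq]
  have hxx : x * x * W = (u - 1) • (x * W) + u • (p a * W) := by
    have h1 : p a * (t * t) * p a * W = (u - 1) • (x * W) + u • (p a * W) := by
      rw [hTT]
      simp only [mul_add, add_mul, mul_smul_comm, smul_mul_assoc, mul_one, hqq, hx]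
    rw [← h1]
    calc x * x * W = p a * t * ((p a * p a) * t * p a * W) := by rw [hx]; noncomm_ring
      _ = p a * t * (∑ b ∈ E, p b * t * p a * W) := by
        rw [hqq, Finset.sum_eq_single a (fun b hb hba => hoff b hb hba)
          (fun h => absurd ha h)]
      _ = p a * t * ((∑ b ∈ E, p b) * t * p a * W) := by simp only [Finset.sum_mul]
      _ = _ := by rw [hsum]; noncomm_ring
  have hWL : Commute W L' := ((Commute.refl L').aeval_right' _).symm
  set D := L' - algebraMap F A a with hD
  have hDL : Commute D L' := (Commute.refl L').sub_left (Algebra.commutes a L')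
  have hWD : Commute W D := hWL.sub_right (Algebra.commutes a W).symm
  have hWDD : ∀ y, y * W * D * D = y * D * D * W := fun y => by
    rw [mul_assoc y W, hWD.eq, ← mul_assoc, mul_assoc _ W, hWD.eq, ← mul_assoc]
  have e1 : x * x * W * D * D = (u - 1) ^ 2 • (p a * L' * L' * W) := by
    calc x * x * W * D * D = x * (x * D) * D * W := by
          rw [hWDD]; noncomm_ring
      _ = (u - 1) • (x * p a * (L' * D) * W) := by
          rw [hxD, mul_smul_comm, smul_mul_assoc, smul_mul_assoc]; noncomm_ring
      _ = (u - 1) • (x * D * L' * W) := by rw [hxp, ← hDL.eq]; noncomm_ring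
      _ = _ := by rw [hxD, smul_mul_assoc, smul_mul_assoc, smul_smul, pow_two]
  have e2 : x * W * D * D = (u - 1) • (p a * L' * D * W) := by
    calc x * W * D * D = x * D * D * W := hWDD x
      _ = _ := by rw [hxD, smul_mul_assoc, smul_mul_assoc]
  have e3 : p a * W * D * D = p a * D * D * W := hWDD _
  have e4 := congrArg (fun y => y * D * D) hxx
  simp only [add_mul, smul_mul_assoc] at e4
  rw [e1, e2, e3, smul_smul] at e4
  simp only [map_mul, map_sub, aeval_X, aeval_C, ← hW, ← hD]
  simp only [← Algebra.smul_def, mul_sub, sub_mul, smul_mul_assoc, mul_smul_comm]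
  rw [sub_sub, sub_eq_zero]
  simp only [← mul_assoc]
  rw [e4]
  ring_nf

/-- The Jucys-Murphy elements are diagonalizable in the presence of an anisotropic
anti-involution fixing the generators. -/
theorem HeckeRel.exists_spectrum (hu : u ≠ 0) (st : A →ₐ[F] Aᵐᵒᵖ)
    (hst : ∀ x, (st x).unop * x = 0 → x = 0) (hsT : ∀ s < N, st (T s) = .op (T s))
    {j : ℕ} (hj : j ≤ N) :
    ∃ E : Finset F, 0 ∉ E ∧ aeval (jucysMurphy u T j) (rootsPoly E) = 0 := by
  induction j with
  | zero => exact ⟨{1}, by simp, by simp [rootsPoly, jucysMurphy]⟩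
  | succ j ih =>
    obtain ⟨E, hE0, hE⟩ := ih (by omega)
    obtain ⟨E', hE0', hE'⟩ := hT.exists_spectrum_succ hu (by omega) hE0 hE
    refine ⟨E', hE0', ?_⟩
    have hL : ∀ i ≤ N, st (jucysMurphy u T i) = .op (jucysMurphy u T i) := by
      intro i hi
      induction i with
      | zero => simp [jucysMurphy]
      | succ i ihi =>
        rw [jucysMurphy, map_smul, map_mul, map_mul, ihi (by omega), hsT i (by omega)]
        simp only [← MulOpposite.op_mul, ← MulOpposite.op_smul, mul_assoc]
    have hself : st (aeval (jucysMurphy u T (j + 1)) (rootsPoly E'))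
        = .op (aeval (jucysMurphy u T (j + 1)) (rootsPoly E')) :=
      map_aeval_of_map_eq_op st (hL _ hj) _
    generalize aeval (jucysMurphy u T (j + 1)) (rootsPoly E') = y at *
    have hy2 : y * y = 0 := by
      apply hst
      rw [map_mul, hself, MulOpposite.unop_mul, MulOpposite.unop_op]
      calc y * y * (y * y) = y ^ 3 * y := by noncomm_ring
        _ = 0 := by rw [hE', zero_mul]
    apply hst
    rw [hself, MulOpposite.unop_op, hy2]

end JucysMurphy

section Splitting

variable {F A : Type*} [Field F] [Ring A] [Algebra F A]

/-- A finite-dimensional algebra with an anisotropic involution is semisimple. -/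
theorem isSemisimpleRing_of_anisotropic [FiniteDimensional F A] (S : Subalgebra F A)
    (st : A →ₐ[F] Aᵐᵒᵖ) (hst : ∀ x, (st x).unop * x = 0 → x = 0)
    (hS : ∀ x ∈ S, (st x).unop ∈ S) (hinv : ∀ x ∈ S, st (st x).unop = .op x) :
    IsSemisimpleRing S := by
  have : IsArtinianRing S := IsArtinianRing.of_finite F S
  rw [IsArtinianRing.isSemisimpleRing_iff_jacobson, eq_bot_iff]
  rintro ⟨x, hx⟩ hxJ
  obtain ⟨n, hn⟩ := IsSemiprimaryRing.isNilpotent (R := S)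
  have hy : (⟨(st x).unop, hS x hx⟩ * ⟨x, hx⟩ : S) ^ n = 0 := by
    have h := Ideal.pow_mem_pow (Ideal.mul_mem_left _ ⟨(st x).unop, hS x hx⟩ hxJ) n
    rw [hn] at h
    simpa using h
  have hy' : ((st x).unop * x) ^ n = 0 := congrArg Subtype.val hy
  have hself : st ((st x).unop * x) = .op ((st x).unop * x) := by
    rw [map_mul, hinv x hx, MulOpposite.op_mul, MulOpposite.op_unop]
  have key : ∀ k : ℕ, ((st x).unop * x) ^ 2 ^ k = 0 → (st x).unop * x = 0 := by
    intro k
    induction k with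
    | zero => simp
    | succ k ih =>
      intro h
      refine ih (hst _ ?_)
      rw [map_pow, hself, ← MulOpposite.op_pow, MulOpposite.unop_op, ← pow_two, ← pow_mul,
        ← pow_succ, h]
  have h0 : x = 0 := hst x (key n (pow_eq_zero_of_le Nat.lt_two_pow_self.le hy'))
  exact Subtype.ext h0

/-- A finite product of matrix algebras has a basis whose products are basis elements or zero. -/
theorem exists_monomial_basis_of_algEquiv {B : Type*} [Ring B] [Algebra F B] {n : ℕ}
    {d : Fin n → ℕ} (e : B ≃ₐ[F] Π i, Matrix (Fin (d i)) (Fin (d i)) F) :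
    ∃ (ι : Type) (_ : Fintype ι) (b : Module.Basis ι F B),
      ∀ i j, b i * b j = 0 ∨ ∃ k, b i * b j = b k := by
  classical
  refine ⟨_, inferInstance,
    (Pi.basis fun i => Matrix.stdBasis F (Fin (d i)) (Fin (d i))).map e.symm.toLinearEquiv, ?_⟩
  rintro ⟨i, a, b⟩ ⟨j, c, f⟩
  simp only [Module.Basis.map_apply, Pi.basis_apply, Matrix.stdBasis_eq_single,
    AlgEquiv.toLinearEquiv_apply, ← map_mul]
  by_cases hij : i = j
  · subst hij
    by_cases hbc : b = c
    · subst hbc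
      refine Or.inr ⟨⟨i, a, f⟩, ?_⟩
      rw [← Pi.single_mul]
      simp [Matrix.stdBasis_eq_single]
    · left
      rw [← Pi.single_mul, Matrix.single_mul_single_of_ne _ _ _ _ hbc]
      simp
  · left
    rw [map_eq_zero_iff _ e.symm.injective]
    ext1 t
    by_cases h : t = i
    · subst h; simp [Pi.single_eq_of_ne hij]
    · simp [Pi.single_eq_of_ne h]

/-- If the Jucys-Murphy elements are diagonalizable, simple left ideals of the algebra
generated by the `T s` have scalar endomorphisms only. -/
theorem HeckeRel.bijective_algebraMap_end {u : F} {N : ℕ} {T : ℕ → A} (hT : HeckeRel u N T)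
    (hu : u ≠ 0) (hu1 : u ≠ 1)
    (hd : ∀ j ≤ N, ∃ E : Finset F, 0 ∉ E ∧ aeval (jucysMurphy u T j) (rootsPoly E) = 0)
    (I : Ideal (parabolic F T N)) [IsSimpleModule (parabolic F T N) I] :
    Function.Bijective (algebraMap F (Module.End (parabolic F T N) I)) := by
  have : Nontrivial I := IsSimpleModule.nontrivial (parabolic F T N) I
  refine ⟨(algebraMap F _).injective, fun φ => ?_⟩
  obtain ⟨x, hx⟩ := exists_ne (0 : I)
  have hxA : ((x : parabolic F T N) : A) ≠ 0 := by simpa using hx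
  obtain ⟨e, he, hex, hez⟩ := hT.exists_one_dim_corner hu hu1 hd le_rfl hxA
  set e' : parabolic F T N := ⟨e, he⟩
  have hv : e' • x ≠ 0 := fun h => hex (congrArg (fun y : I => ((y : parabolic F T N) : A)) h)
  obtain ⟨z, hz⟩ := IsSimpleModule.toSpanSingleton_surjective (parabolic F T N) hv (φ x)
  obtain ⟨t, ht⟩ := hez z z.2
  have ht' : e' * z * e' = t • e' := Subtype.ext ht
  refine ⟨t, ?_⟩
  ext1 y
  obtain ⟨w, rfl⟩ := IsSimpleModule.toSpanSingleton_surjective (parabolic F T N) hv y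
  rw [LinearMap.toSpanSingleton_apply] at hz
  have hφ : φ (e' • x) = t • e' • x := by
    rw [map_smul, ← hz, smul_smul z, smul_smul e', ← mul_assoc, ht', smul_assoc]
  rw [LinearMap.toSpanSingleton_apply, map_smul φ, hφ, Module.algebraMap_end_apply, smul_comm t]

/-- A Hecke algebra quotient with an anisotropic involution is split semisimple. -/
theorem HeckeRel.exists_monomial_basis [FiniteDimensional F A] {u : F} {N : ℕ} {T : ℕ → A}
    (hT : HeckeRel u N T) (hu : u ≠ 0) (hu1 : u ≠ 1) (st : A →ₐ[F] Aᵐᵒᵖ)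
    (hst : ∀ x, (st x).unop * x = 0 → x = 0) (hsT : ∀ s < N, st (T s) = .op (T s)) :
    ∃ (ι : Type) (_ : Fintype ι) (b : Module.Basis ι F (parabolic F T N)),
      ∀ i j, b i * b j = 0 ∨ ∃ k, b i * b j = b k := by
  have hS : ∀ x ∈ parabolic F T N, (st x).unop ∈ parabolic F T N ∧ st (st x).unop = .op x := by
    intro x hx
    induction hx using Algebra.adjoin_induction with
    | mem x hx =>
      obtain ⟨s, hs, rfl⟩ := hx
      rw [hsT s hs]
      exact ⟨gen_mem_parabolic T hs, by simp [hsT s hs]⟩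
    | algebraMap r => 
      rw [AlgHom.commutes, MulOpposite.algebraMap_apply, MulOpposite.unop_op, AlgHom.commutes]
      exact ⟨algebraMap_mem _ r, rfl⟩
    | add x y _ _ hx hy =>
      simp only [map_add, MulOpposite.unop_add, MulOpposite.op_add]
      exact ⟨add_mem hx.1 hy.1, by rw [hx.2, hy.2]⟩
    | mul x y _ _ hx hy =>
      simp only [map_mul, MulOpposite.unop_mul, MulOpposite.op_mul]
      exact ⟨mul_mem hy.1 hx.1, by rw [hx.2, hy.2]⟩
  have : IsSemisimpleRing (parabolic F T N) :=
    isSemisimpleRing_of_anisotropic _ st hst (fun x hx => (hS x hx).1) fun x hx => (hS x hx).2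
  obtain ⟨n, I, d, hI, -, ⟨e⟩⟩ :=
    IsSemisimpleRing.exists_algEquiv_pi_matrix_end_mulOpposite F (parabolic F T N)
  have hbij : ∀ i, Function.Bijective
      (Algebra.ofId F (Module.End (parabolic F T N) (I i))ᵐᵒᵖ) := fun i =>
    MulOpposite.op_bijective.comp
      (hT.bijective_algebraMap_end hu hu1 (fun j hj => hT.exists_spectrum hu st hst hsT hj) (I i))
  exact exists_monomial_basis_of_algEquiv (e.trans
    (AlgEquiv.piCongrRight fun i => (AlgEquiv.ofBijective _ (hbij i)).symm.mapMatrix))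

end Splitting

section RMatrix

open Matrix

variable {F : Type*} [Field F] (u : F) {k n : ℕ}

theorem vecMul_RMat (s t : Fin n) (v : (Fin n → Fin k) → F) (f : Fin n → Fin k) :
    (v ᵥ* RMat F u k n s t) f =
      (if f s = f t then u else if f s < f t then 0 else u - 1) * v f +
      (if f s = f t then 0 else if f s < f t then 1 else u) * v (swapAt k n s t f) := by
  have hne : f s ≠ f t → swapAt k n s t f ≠ f := fun h h' => h <| by
    simpa [swapAt] using (congrFun h' s).symm
  have hlt : ((f s : ℕ) < f t) = (f s < f t) := rfl
  simp only [Matrix.vecMul, dotProduct, RMat, Matrix.of_apply, hlt]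
  split_ifs with h1 h2
  · simp [mul_comm]
  · simp
  · have : ∀ g : Fin n → Fin k,
        (v g * if g = f then u - 1 else if g = swapAt k n s t f then u else 0) =
        (if g = f then (u - 1) * v g else 0) + if g = swapAt k n s t f then u * v g else 0 := by
      intro g
      by_cases hg : g = f
      · subst hg; simp [(hne h1).symm, mul_comm]
      · simp [hg, mul_comm]
    simp [this, Finset.sum_add_distrib]

theorem matrix_eq_of_vecMul_eq {ι : Type*} [Fintype ι] [DecidableEq ι] {M N : Matrix ι ι F}
    (h : ∀ v i, (v ᵥ* M) i = (v ᵥ* N) i) : M = N := by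
  ext i j
  simpa using h (Pi.single i 1) j

theorem RMat_mul_self {s t : Fin n} (hst : s ≠ t) :
    RMat F u k n s t * RMat F u k n s t = (u - 1) • RMat F u k n s t + u • 1 := by
  refine matrix_eq_of_vecMul_eq fun v f => ?_
  have h1 : swapAt k n s t f s = f t := by simp [swapAt]
  have h2 : swapAt k n s t f t = f s := by simp [swapAt, hst.symm]
  have h3 : swapAt k n s t (swapAt k n s t f) = f := by
    ext1 i; simp only [swapAt]; split_ifs <;> simp_all
  rw [← Matrix.vecMul_vecMul, Matrix.vecMul_add, Matrix.vecMul_smul, Matrix.vecMul_smul,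
    Matrix.vecMul_one]
  simp only [Pi.add_apply, Pi.smul_apply, smul_eq_mul, vecMul_RMat, h1, h2, h3]
  rcases lt_trichotomy (f s) (f t) with h | h | h
  · simp only [h, h.ne, h.ne', h.not_gt, if_true, if_false]; ring
  · simp only [h, if_true]; ring
  · simp only [h, h.ne, h.ne', h.not_gt, if_true, if_false]; ring

theorem RMat_braid {s t r : Fin n} (hst : s ≠ t) (htr : t ≠ r) (hsr : s ≠ r) :
    RMat F u k n s t * RMat F u k n t r * RMat F u k n s t =
      RMat F u k n t r * RMat F u k n s t * RMat F u k n t r := by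
  refine matrix_eq_of_vecMul_eq fun v f => ?_
  let W : Fin k → Fin k → Fin k → Fin n → Fin k := fun x y z i =>
    if i = s then x else if i = t then y else if i = r then z else f i
  have hf : W (f s) (f t) (f r) = f := by
    ext1 i; simp only [W]; split_ifs <;> simp_all
  have h1 : ∀ x y z, W x y z s = x := fun x y z => by simp [W]
  have h2 : ∀ x y z, W x y z t = y := fun x y z => by simp [W, hst.symm]
  have h3 : ∀ x y z, W x y z r = z := fun x y z => by simp [W, hsr.symm, htr.symm]
  have h4 : ∀ x y z, swapAt k n s t (W x y z) = W y x z := fun x y z => by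
    ext1 i; simp only [swapAt, h1, h2]; simp only [W]; split_ifs <;> simp_all
  have h5 : ∀ x y z, swapAt k n t r (W x y z) = W x z y := fun x y z => by
    ext1 i; simp only [swapAt, h2, h3]; simp only [W]; split_ifs <;> simp_all
  simp only [← Matrix.vecMul_vecMul]
  rw [← hf]
  generalize f s = a, f t = b, f r = c
  simp only [vecMul_RMat, h1, h2, h3, h4, h5]
  clear_value W
  rcases lt_trichotomy a b with h | h | h <;> rcases lt_trichotomy b c with h' | h' | h' <;>
  rcases lt_trichotomy a c with h'' | h'' | h'' <;> try omega
  all_goals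
    first
    | subst h; subst h'; simp only [if_true]
    | subst h; simp only [h', h'.ne, h'.ne', h'.not_gt, if_true, if_false]
    | subst h'; simp only [h, h.ne, h.ne', h.not_gt, if_true, if_false]
    | subst h''; simp only [h, h.ne, h.ne', h.not_gt, if_true, if_false]
    | simp only [h, h.ne, h.ne', h.not_gt, h', h'.ne, h'.ne', h'.not_gt, h'', h''.ne, h''.ne',
        h''.not_gt, if_true, if_false]
  all_goals ring

theorem RMat_commute {s t p q : Fin n} (hst : s ≠ t) (hpq : p ≠ q) (hsp : s ≠ p) (hsq : s ≠ q)
    (htp : t ≠ p) (htq : t ≠ q) : Commute (RMat F u k n s t) (RMat F u k n p q) := by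
  refine matrix_eq_of_vecMul_eq fun v f => ?_
  let W : Fin k → Fin k → Fin k → Fin k → Fin n → Fin k := fun x y z w i =>
    if i = s then x else if i = t then y else if i = p then z else if i = q then w else f i
  have hf : W (f s) (f t) (f p) (f q) = f := by
    ext1 i; simp only [W]; split_ifs <;> simp_all
  have h1 : ∀ x y z w, W x y z w s = x := fun x y z w => by simp [W]
  have h2 : ∀ x y z w, W x y z w t = y := fun x y z w => by simp [W, hst.symm]
  have h3 : ∀ x y z w, W x y z w p = z := fun x y z w => by simp [W, hsp.symm, htp.symm]
  have h4 : ∀ x y z w, W x y z w q = w := fun x y z w => by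
    simp [W, hsq.symm, htq.symm, hpq.symm]
  have h5 : ∀ x y z w, swapAt k n s t (W x y z w) = W y x z w := fun x y z w => by
    ext1 i; simp only [swapAt, h1, h2]; simp only [W]; split_ifs <;> simp_all
  have h6 : ∀ x y z w, swapAt k n p q (W x y z w) = W x y w z := fun x y z w => by
    ext1 i; simp only [swapAt, h3, h4]; simp only [W]; split_ifs <;> simp_all
  simp only [← Matrix.vecMul_vecMul]
  rw [← hf]
  simp only [vecMul_RMat, h1, h2, h3, h4, h5, h6]
  ring

/-- The number of inversions of a word. -/
def inversions (f : Fin n → Fin k) : ℕ :=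
  (Finset.univ.filter fun p : Fin n × Fin n => p.1 < p.2 ∧ f p.2 < f p.1).card

theorem inversions_swapAt {f : Fin n → Fin k} {s t : Fin n} (hst : (t : ℕ) = s + 1)
    (h : f s < f t) : inversions (swapAt k n s t f) = inversions f + 1 := by
  have hτ : ∀ i, swapAt k n s t f (Equiv.swap s t i) = f i := by
    intro i
    simp only [swapAt, Equiv.swap_apply_def]
    split_ifs <;> simp_all
  have h1 : inversions (swapAt k n s t f) =
      (insert (t, s) (Finset.univ.filter fun p : Fin n × Fin n =>
        p.1 < p.2 ∧ f p.2 < f p.1)).card := by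
    refine (Finset.card_equiv ((Equiv.swap s t).prodCongr (Equiv.swap s t)) ?_).symm
    rintro ⟨a, b⟩
    simp only [Finset.mem_insert, Finset.mem_filter, Finset.mem_univ, true_and, Prod.mk.injEq,
      Equiv.prodCongr_apply, Prod.map_apply, hτ]
    by_cases hab : f b < f a
    · have h2 : ¬ (a = s ∧ b = t) := by rintro ⟨rfl, rfl⟩; exact absurd h hab.not_gt
      have h3 : a ≠ b := by rintro rfl; exact lt_irrefl _ hab
      simp only [hab, and_true]
      simp only [Equiv.swap_apply_def]
      split_ifs <;> simp only [Fin.lt_def, Fin.ext_iff] at * <;> omega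
    · simp only [hab, and_false, or_false, iff_false]
      rintro ⟨rfl, rfl⟩
      exact hab h
  rw [h1, Finset.card_insert_of_notMem, inversions]
  have : ¬ t < s := by rw [Fin.lt_def]; omega
  simp [this]

theorem inversions_mul_RMat {s t : Fin n} (hst : (t : ℕ) = s + 1) :
    (diagonal fun f => u ^ inversions f) * RMat F u k n s t =
      (RMat F u k n s t)ᵀ * diagonal fun f => u ^ inversions f := by
  have hne : s ≠ t := fun h => by rw [h] at hst; omega
  have key : ∀ f g : Fin n → Fin k, f s < f t →
      u ^ inversions g * RMat F u k n s t g f = RMat F u k n s t f g * u ^ inversions f := by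
    intro f g h
    have h2 : swapAt k n s t (swapAt k n s t f) = f := by
      ext1 i; simp only [swapAt]; split_ifs <;> simp_all
    by_cases hg : g = swapAt k n s t f
    · subst hg
      have h1 : swapAt k n s t f ≠ f := fun h' => h.ne <| by
        simpa [swapAt] using (congrFun h' s).symm
      have h3 : swapAt k n s t f s = f t := by simp [swapAt]
      have h4 : swapAt k n s t f t = f s := by simp [swapAt, hne.symm]
      rw [inversions_swapAt hst h]
      simp [RMat, h.ne, h.ne', h3, h4, h1.symm, h2, h, h.not_gt, pow_succ']
    · have h3 : RMat F u k n s t g f = 0 := by simp [RMat, h.ne, h, hg]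
      have h5 : f ≠ swapAt k n s t g := fun h' => hg <| by
        rw [h']; ext1 i; simp only [swapAt]; split_ifs <;> simp_all
      have h6 : g ≠ f → RMat F u k n s t f g = 0 := fun h6 => by
        simp [RMat, h5, h6.symm]
      by_cases h7 : g = f
      · subst h7; rw [h3]; simp
      · rw [h3, h6 h7]; simp
  have key' : ∀ f g : Fin n → Fin k, ¬ f s < f t → ¬ g s < g t → f ≠ g →
      RMat F u k n s t g f = 0 := by
    intro f g hf hg hne'
    by_cases h : f s = f t
    · simp [RMat, h, hne'.symm]
    · have h1 : g ≠ swapAt k n s t f := by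
        rintro rfl
        have h3 : swapAt k n s t f s = f t := by simp [swapAt]
        have h4 : swapAt k n s t f t = f s := by simp [swapAt, hne.symm]
        rw [h3, h4] at hg
        exact h (le_antisymm (not_lt.1 hg) (not_lt.1 hf))
      simp [RMat, h, hf, h1, hne'.symm]
  ext g f
  rw [diagonal_mul, mul_diagonal, transpose_apply]
  by_cases hf : f s < f t
  · exact key f g hf
  by_cases hg : g s < g t
  · rw [mul_comm, ← key g f hg, mul_comm]
  rcases eq_or_ne f g with rfl | h
  · exact mul_comm _ _
  · rw [key' f g hf hg h, key' g f hg hf h.symm, mul_zero, zero_mul]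

/-- The operators of Jimbo's representation, as matrices. -/
def jimbo (F : Type*) [Field F] (u : F) (k n : ℕ) (s : ℕ) :
    Matrix (Fin n → Fin k) (Fin n → Fin k) F :=
  if h : s + 1 < n then RMat F u k n ⟨s, Nat.lt_of_succ_lt h⟩ ⟨s + 1, h⟩ else 0

theorem jimbo_of_lt {s : ℕ} (h : s + 1 < n) :
    jimbo F u k n s = RMat F u k n ⟨s, Nat.lt_of_succ_lt h⟩ ⟨s + 1, h⟩ := dif_pos h

theorem heckeRel_jimbo : HeckeRel u (n - 1) (jimbo F u k n) where
  quad s hs := by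
    rw [jimbo_of_lt u (by omega)]
    exact RMat_mul_self u (by simp)
  braid s hs := by
    rw [jimbo_of_lt u (by omega), jimbo_of_lt u (by omega)]
    exact RMat_braid u (by simp) (by simp) (by simp; omega)
  far s t hst ht := by
    rw [jimbo_of_lt u (by omega), jimbo_of_lt u (by omega)]
    apply RMat_commute u <;> simp only [ne_eq, Fin.mk.injEq] <;> omega

/-- The anti-involution of the matrix algebra fixing the operators of Jimbo's representation. -/
noncomputable def antiInvolution (hu : u ≠ 0) (k n : ℕ) :
    Matrix (Fin n → Fin k) (Fin n → Fin k) F →ₐ[F]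
      (Matrix (Fin n → Fin k) (Fin n → Fin k) F)ᵐᵒᵖ where
  toFun X := .op ((diagonal fun f => (u ^ inversions f)⁻¹) * Xᵀ *
    diagonal fun f => u ^ inversions f)
  map_one' := by simp [hu]
  map_mul' X Y := by
    have h : ((diagonal fun f => u ^ inversions f) * diagonal fun f => (u ^ inversions f)⁻¹ :
        Matrix (Fin n → Fin k) (Fin n → Fin k) F) = 1 := by simp [hu]
    rw [← MulOpposite.op_mul, transpose_mul]
    congr 1
    calc _ = (diagonal fun f => (u ^ inversions f)⁻¹) * Yᵀ * 1 * Xᵀ *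
          diagonal fun f => u ^ inversions f := by noncomm_ring
      _ = _ := by rw [← h]; noncomm_ring
  map_zero' := by simp
  map_add' X Y := by
    rw [← MulOpposite.op_add, transpose_add]
    congr 1
    noncomm_ring
  commutes' r := by
    rw [MulOpposite.algebraMap_apply, algebraMap_eq_diagonal, diagonal_transpose,
      diagonal_mul_diagonal, diagonal_mul_diagonal]
    congr 2
    ext f
    simp [mul_right_comm _ r, hu]

theorem antiInvolution_jimbo (hu : u ≠ 0) {s : ℕ} (hs : s < n - 1) :
    antiInvolution u hu k n (jimbo F u k n s) = .op (jimbo F u k n s) := by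
  rw [jimbo_of_lt u (by omega)]
  change MulOpposite.op _ = _
  rw [mul_assoc, ← inversions_mul_RMat u rfl, ← mul_assoc]
  simp [hu]

theorem antiInvolution_anisotropic (hu : u ≠ 0) (ι : F →+* ℝ) (hι : 0 < ι u)
    (X : Matrix (Fin n → Fin k) (Fin n → Fin k) F)
    (hX : (antiInvolution u hu k n X).unop * X = 0) : X = 0 := by
  change (diagonal fun f => (u ^ inversions f)⁻¹) * Xᵀ * (diagonal fun f => u ^ inversions f) * X
    = 0 at hX
  ext i j
  have h := Matrix.ext_iff.2 hX j j
  rw [mul_assoc, mul_assoc, diagonal_mul] at h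
  rw [Matrix.zero_apply] at h
  have h' := congrArg ι ((mul_eq_zero.1 h).resolve_left (inv_ne_zero (pow_ne_zero _ hu)))
  rw [mul_apply] at h'
  simp only [transpose_apply, diagonal_mul, map_sum, map_mul, map_pow, map_zero] at h'
  have h2 : ∀ g : Fin n → Fin k,
      ι (X g j) * (ι u ^ inversions g * ι (X g j)) = ι u ^ inversions g * ι (X g j) ^ 2 :=
    fun g => by ring
  simp only [h2] at h'
  rw [Finset.sum_eq_zero_iff_of_nonneg (fun g _ => by positivity)] at h'
  have h3 := h' i (Finset.mem_univ i)
  simpa [hι.ne', hu] using h3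

end RMatrix

section Specialization

theorem exists_ratFunc_ringHom {K L : Type*} [Field K] [Field L] [Algebra K L] {t : L}
    (ht : Transcendental K t) : ∃ σ : RatFunc K →+* L, σ RatFunc.X = t := by
  have hinj : Function.Injective (aeval t : K[X] →ₐ[K] L) :=
    transcendental_iff_injective.1 ht
  refine ⟨(RatFunc.liftAlgHom (aeval t : K[X] →ₐ[K] L)
    (nonZeroDivisors_le_comap_nonZeroDivisors_of_injective _ hinj)).toRingHom, ?_⟩
  have := RatFunc.liftAlgHom_apply_div (aeval t : K[X] →ₐ[K] L)
    (nonZeroDivisors_le_comap_nonZeroDivisors_of_injective _ hinj) X 1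
  simpa using this

theorem exists_ratFunc_ringHom_real : ∃ ι : RatFunc ℚ →+* ℝ, 0 < ι RatFunc.X := by
  have hL : Transcendental ℚ (liouvilleNumber 2) := fun h =>
    transcendental_liouvilleNumber (m := 2) le_rfl
      (by exact_mod_cast (IsFractionRing.isAlgebraic_iff ℤ ℚ ℝ).2 h)
  obtain ⟨ι, hι⟩ := exists_ratFunc_ringHom hL
  refine ⟨ι, ?_⟩
  rw [hι]
  exact (LiouvilleNumber.summable one_lt_two).tsum_pos (fun i => by positivity) 0 (by positivity)

theorem exists_ratFunc_ringHom_X_pow (K : Type*) [Field K] [CharZero K] {l : ℕ} (hl : l ≠ 0) :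
    ∃ σ : RatFunc ℚ →+* RatFunc K, σ RatFunc.X = RatFunc.X ^ l :=
  exists_ratFunc_ringHom fun h =>
    RatFunc.transcendental_X (K := K) ((h.of_pow (Nat.pos_of_ne_zero hl)).tower_top K)

/-- Over `ℚ(x)`, the algebra generated by Jimbo's operators is split semisimple. -/
theorem exists_monomial_basis_jimbo (k m : ℕ) :
    ∃ (ι : Type) (_ : Fintype ι) (b : Module.Basis ι (RatFunc ℚ)
      (parabolic (RatFunc ℚ) (jimbo (RatFunc ℚ) RatFunc.X k m) (m - 1))),
      ∀ i j, b i * b j = 0 ∨ ∃ k, b i * b j = b k := by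
  obtain ⟨ι, hι⟩ := exists_ratFunc_ringHom_real
  have hX : (RatFunc.X : RatFunc ℚ) ≠ 0 := RatFunc.X_ne_zero
  have hX1 : (RatFunc.X : RatFunc ℚ) ≠ 1 := by
    rw [← RatFunc.algebraMap_X, ← map_one (algebraMap ℚ[X] (RatFunc ℚ))]
    exact fun h => X_ne_C (1 : ℚ) (RatFunc.algebraMap_injective ℚ h)
  exact (heckeRel_jimbo RatFunc.X).exists_monomial_basis hX hX1 (antiInvolution _ hX k m)
    (antiInvolution_anisotropic _ hX ι hι) fun s hs => antiInvolution_jimbo _ hX hs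

end Specialization

section BaseChange

variable {K L : Type*} [Field K] [Field L] (σ : K →+* L)

theorem linearIndependent_mapMatrix {ι p : Type*} [Fintype p] [DecidableEq p]
    {v : ι → Matrix p p K} (hv : LinearIndependent K v) :
    LinearIndependent L fun i => σ.mapMatrix (v i) := by
  let : Algebra K L := σ.toAlgebra
  have h1 : LinearIndependent K fun i => (LinearEquiv.curry K K p p).symm (v i) :=
    hv.map' _ (LinearEquiv.curry K K p p).symm.ker
  have h2 := (linearIndependent_algebraMap_comp_iff (S := L)).2 h1
  exact h2.map' _ (LinearEquiv.curry L L p p).ker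

/-- Bases of algebras of matrices generated by some elements are stable under base change. -/
theorem exists_basis_parabolic_mapMatrix {ι p : Type*} [Fintype ι] [Fintype p] [DecidableEq p]
    {T : ℕ → Matrix p p K} {T' : ℕ → Matrix p p L} (hT : ∀ s, σ.mapMatrix (T s) = T' s) {N : ℕ}
    (b : Module.Basis ι K (parabolic K T N)) :
    ∃ c : Module.Basis ι L (parabolic L T' N),
      ∀ i, (c i : Matrix p p L) = σ.mapMatrix (b i : Matrix p p K) := by
  obtain rfl := funext hT
  have hsmul : ∀ (r : K) (x : Matrix p p K), σ.mapMatrix (r • x) = σ r • σ.mapMatrix x := by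
    intro r x; ext; simp
  have halg : ∀ r : K, σ.mapMatrix (algebraMap K (Matrix p p K) r) = algebraMap L _ (σ r) := by
    intro r; rw [Algebra.algebraMap_eq_smul_one, hsmul, map_one, Algebra.algebraMap_eq_smul_one]
  have hmem : ∀ x ∈ parabolic K T N,
      σ.mapMatrix x ∈ parabolic L (fun s => σ.mapMatrix (T s)) N := by
    intro x hx
    induction hx using Algebra.adjoin_induction with
    | mem x hx =>
      obtain ⟨s, hs, rfl⟩ := hx
      exact gen_mem_parabolic (fun s => σ.mapMatrix (T s)) hs
    | algebraMap r => rw [halg]; exact algebraMap_mem _ _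
    | add x y _ _ hx hy => rw [map_add]; exact add_mem hx hy
    | mul x y _ _ hx hy => rw [map_mul]; exact mul_mem hx hy
  let v : ι → parabolic L (fun s => σ.mapMatrix (T s)) N := fun i =>
    ⟨σ.mapMatrix (b i : Matrix p p K), hmem _ (b i).2⟩
  have hli : LinearIndependent L v := by
    refine LinearIndependent.of_comp (Subalgebra.val _).toLinearMap ?_
    exact linearIndependent_mapMatrix σ
      (b.linearIndependent.map' (Subalgebra.val _).toLinearMap
        (LinearMap.ker_eq_bot.2 Subtype.val_injective))
  set W := Submodule.span L (Set.range fun i => σ.mapMatrix (b i : Matrix p p K)) with hW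
  have hspan : ∀ x ∈ parabolic K T N, σ.mapMatrix x ∈ W := by
    intro x hx
    have h : x = ∑ i, b.repr ⟨x, hx⟩ i • (b i : Matrix p p K) := by
      have := congrArg (Subalgebra.val _) (b.sum_repr ⟨x, hx⟩)
      rw [map_sum] at this
      exact this.symm
    rw [h, map_sum]
    refine sum_mem fun i _ => ?_
    rw [hsmul]
    exact W.smul_mem _ (Submodule.subset_span ⟨i, rfl⟩)
  have hWW : W * W ≤ W := by
    rw [hW, Submodule.span_mul_span, Submodule.span_le]
    rintro _ ⟨_, ⟨i, rfl⟩, _, ⟨j, rfl⟩, rfl⟩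
    simp only [← map_mul]
    exact hspan _ (mul_mem (b i).2 (b j).2)
  have htop : ∀ y ∈ parabolic L (fun s => σ.mapMatrix (T s)) N, y ∈ W := by
    intro y hy
    induction hy using Algebra.adjoin_induction with
    | mem x hx =>
      obtain ⟨s, hs, rfl⟩ := hx
      exact hspan _ (gen_mem_parabolic T hs)
    | algebraMap r =>
      rw [Algebra.algebraMap_eq_smul_one, ← map_one (σ.mapMatrix (m := p))]
      exact W.smul_mem _ (hspan _ (one_mem _))
    | add x y _ _ hx hy => exact add_mem hx hy
    | mul x y _ _ hx hy => exact hWW (Submodule.mul_mem_mul hx hy)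
  refine ⟨Module.Basis.mk hli ?_, fun i => by simp [v]⟩
  rintro ⟨y, hy⟩ -
  have h1 : W = (Submodule.span L (Set.range v)).map (Subalgebra.val _).toLinearMap := by
    rw [Submodule.map_span, ← Set.range_comp]
    rfl
  obtain ⟨z, hz, hzy⟩ := (h1 ▸ htop y hy : y ∈ (Submodule.span L (Set.range v)).map _)
  have h2 : (⟨y, hy⟩ : parabolic L (fun s => σ.mapMatrix (T s)) N) = z := Subtype.ext hzy.symm
  rwa [h2]

theorem mapMatrix_jimbo (u : K) (k n s : ℕ) :
    σ.mapMatrix (jimbo K u k n s) = jimbo L (σ u) k n s := by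
  unfold jimbo
  split_ifs
  · ext g f
    simp only [RMat, RingHom.mapMatrix_apply, Matrix.map_apply, Matrix.of_apply]
    split_ifs <;> simp
  · simp

/-- The algebras generated by Jimbo's operators for two specializations of the generic parameter
are isomorphic. -/
theorem exists_linearEquiv_parabolic_jimbo (k m : ℕ) (σ τ : RatFunc ℚ →+* L) :
    ∃ φ : parabolic L (jimbo L (σ RatFunc.X) k m) (m - 1) ≃ₗ[L]
        parabolic L (jimbo L (τ RatFunc.X) k m) (m - 1),
      ∀ x y, φ (x * y) = φ x * φ y := by
  obtain ⟨ι, _, b, hb⟩ := exists_monomial_basis_jimbo k m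
  obtain ⟨c, hc⟩ := exists_basis_parabolic_mapMatrix σ (mapMatrix_jimbo σ _ k m) b
  obtain ⟨d, hd⟩ := exists_basis_parabolic_mapMatrix τ (mapMatrix_jimbo τ _ k m) b
  refine ⟨c.equiv d (Equiv.refl ι), fun x y => ?_⟩
  set φ := c.equiv d (Equiv.refl ι) with hφ
  have hφc : ∀ i, φ (c i) = d i := fun i => by simp [hφ]
  have key : (LinearMap.mul L (parabolic L (jimbo L (σ RatFunc.X) k m) (m - 1))).compr₂
      φ.toLinearMap = (LinearMap.mul L _).compl₁₂ φ.toLinearMap φ.toLinearMap := by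
    refine c.ext fun i => c.ext fun j => ?_
    simp only [LinearMap.compr₂_apply, LinearMap.compl₁₂_apply, LinearMap.mul_apply',
      LinearEquiv.coe_coe, hφc]
    rcases hb i j with h | ⟨k, h⟩
    · have h' := congrArg Subtype.val h
      have h1 : c i * c j = 0 := Subtype.ext <| by
        simpa [hc, ← Matrix.map_mul] using congrArg σ.mapMatrix h'
      have h2 : d i * d j = 0 := Subtype.ext <| by
        simpa [hd, ← Matrix.map_mul] using congrArg τ.mapMatrix h'
      rw [h1, h2, map_zero]
    · have h' := congrArg Subtype.val h
      have h1 : c i * c j = c k := Subtype.ext <| by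
        simpa [hc] using congrArg σ.mapMatrix h'
      have h2 : d i * d j = d k := Subtype.ext <| by
        simpa [hd] using congrArg τ.mapMatrix h'
      rw [h1, h2, hφc]
  exact LinearMap.congr_fun₂ key x y

end BaseChange

section Embedding

open Matrix

variable (F : Type*) [Field F] (k m r : ℕ)

/-- Operators on the first `m` tensor factors as operators on `m + r` tensor factors. -/
def tensorOne : Matrix (Fin m → Fin k) (Fin m → Fin k) F →ₐ[F]
    Matrix (Fin (m + r) → Fin k) (Fin (m + r) → Fin k) F :=
  (reindexAlgEquiv F F (Fin.appendEquiv m r)).toAlgHom.comp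
    { toFun := fun X => blockDiagonal fun _ : Fin r → Fin k => X
      map_one' := blockDiagonal_one
      map_mul' := fun X Y => blockDiagonal_mul (fun _ => X) fun _ => Y
      map_zero' := blockDiagonal_zero
      map_add' := fun X Y => blockDiagonal_add (fun _ => X) fun _ => Y
      commutes' := fun c => by
        rw [algebraMap_eq_diagonal, algebraMap_eq_diagonal]
        exact blockDiagonal_diagonal _ }

theorem tensorOne_apply (X : Matrix (Fin m → Fin k) (Fin m → Fin k) F)
    (g f : Fin (m + r) → Fin k) :
    tensorOne F k m r X g f = if (fun i => g (Fin.natAdd m i)) = (fun i => f (Fin.natAdd m i))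
      then X (fun i => g (Fin.castAdd r i)) fun i => f (Fin.castAdd r i) else 0 := by
  rfl

theorem tensorOne_injective (hk : k ≠ 0) : Function.Injective (tensorOne F k m r) := by
  intro X Y h
  have h' : blockDiagonal (fun _ : Fin r → Fin k => X) = blockDiagonal fun _ => Y :=
    (reindexAlgEquiv F F (Fin.appendEquiv m r)).injective h
  exact congrFun (blockDiagonal_injective h') fun _ => ⟨0, Nat.pos_of_ne_zero hk⟩

theorem tensorOne_jimbo (u : F) {s : ℕ} (hs : s < m - 1) :
    tensorOne F k m r (jimbo F u k m s) = jimbo F u k (m + r) s := by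
  rw [jimbo_of_lt u (by omega), jimbo_of_lt u (by omega)]
  set a : Fin m := ⟨s, by omega⟩
  set b : Fin m := ⟨s + 1, by omega⟩
  change _ = RMat F u k (m + r) (Fin.castAdd r a) (Fin.castAdd r b)
  have hext : ∀ g f : Fin (m + r) → Fin k,
      g = f ↔ (fun i => g (Fin.castAdd r i)) = (fun i => f (Fin.castAdd r i)) ∧
        (fun i => g (Fin.natAdd m i)) = fun i => f (Fin.natAdd m i) := by
    intro g f
    rw [← (Fin.appendEquiv m r).symm.injective.eq_iff, Prod.ext_iff]
    rfl
  have h1 : ∀ f : Fin (m + r) → Fin k, (fun i => swapAt k (m + r) (Fin.castAdd r a)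
      (Fin.castAdd r b) f (Fin.castAdd r i)) = swapAt k m a b fun i => f (Fin.castAdd r i) := by
    intro f
    ext1 i
    simp [swapAt]
  have h2 : ∀ f : Fin (m + r) → Fin k, (fun i => swapAt k (m + r) (Fin.castAdd r a)
      (Fin.castAdd r b) f (Fin.natAdd m i)) = fun i => f (Fin.natAdd m i) := by
    intro f
    ext1 i
    have h3 : ∀ j : Fin m, Fin.natAdd m i ≠ Fin.castAdd r j := fun j h => by
      have := congrArg Fin.val h
      simp at this
      omega
    simp [swapAt, h3]
  ext g f
  rw [tensorOne_apply]
  simp only [RMat, Matrix.of_apply, hext g f, hext g (swapAt _ _ _ _ f), h1, h2]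
  by_cases h : (fun i => g (Fin.natAdd m i)) = fun i => f (Fin.natAdd m i)
  · simp [h]
  · simp [h]

/-- The algebra generated by Jimbo's operators on `m` factors embeds in the one on more factors. -/
theorem exists_algHom_parabolic_jimbo (u : F) (hk : k ≠ 0) {n : ℕ} (hmn : m ≤ n) :
    ∃ ψ : parabolic F (jimbo F u k m) (m - 1) →ₐ[F] parabolic F (jimbo F u k n) (n - 1),
      Function.Injective ψ := by
  obtain ⟨r, rfl⟩ := Nat.exists_eq_add_of_le hmn
  have hle : (parabolic F (jimbo F u k m) (m - 1)).map (tensorOne F k m r) ≤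
      parabolic F (jimbo F u k (m + r)) (m + r - 1) := by
    rw [parabolic, AlgHom.map_adjoin, Algebra.adjoin_le_iff]
    rintro _ ⟨_, ⟨s, hs, rfl⟩, rfl⟩
    have hs' : s < m - 1 := hs
    rw [tensorOne_jimbo F k m r u hs]
    exact gen_mem_parabolic _ (by omega)
  exact ⟨((tensorOne F k m r).comp (Subalgebra.val _)).codRestrict _
    fun x => hle ⟨x, x.2, rfl⟩, fun x y h => Subtype.ext <|
      tensorOne_injective F k m r hk (congrArg Subtype.val h)⟩

theorem nonempty_algEquiv_rowQuotient (u : F) (n : ℕ) :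
    Nonempty (parabolic F (jimbo F u k n) (n - 1) ≃ₐ[F] RowQuotient F u k n) := by
  have h : (parabolic F (jimbo F u k n) (n - 1)).map
      (Matrix.toLinAlgEquiv' (R := F) (n := Fin n → Fin k)).toAlgHom = RowQuotient F u k n := by
    rw [parabolic, AlgHom.map_adjoin, RowQuotient]
    congr 1
    ext X
    constructor
    · rintro ⟨_, ⟨s, hs, rfl⟩, rfl⟩
      have hs' : s < n - 1 := hs
      refine ⟨s, by omega, ?_⟩
      rw [jimbo_of_lt u (by omega)]
      rfl
    · rintro ⟨s, hs, rfl⟩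
      refine ⟨_, ⟨s, by change s < n - 1; omega, rfl⟩, ?_⟩
      rw [jimbo_of_lt u hs]
      rfl
  exact ⟨(AlgEquiv.subalgebraMap _ _).trans (Subalgebra.equivOfEq _ _ h)⟩

end Embedding

end RowQuotientTransport

/-- For `n = m·l + (l-1)·k(k-1)/2`, the `k`-row quotient of the
generic Hecke algebra `H_n(x)` over `K(x)` contains a (non-unital) subalgebra
isomorphic to the `k`-row quotient of `H_m(x^l)`: there is an injective `K(x)`-linear
multiplicative map from the latter to the former. -/
theorem stmt_15 (K : Type*) [Field K] [CharZero K]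
    (k l m n : ℕ) (hk : 2 ≤ k) (hl : 2 ≤ l) (hm : 1 ≤ m)
    (hn : n = m * l + (l - 1) * (k * (k - 1) / 2)) :
    ∃ φ : RowQuotient (RatFunc K) (RatFunc.X ^ l) k m →ₗ[RatFunc K]
        RowQuotient (RatFunc K) RatFunc.X k n,
      Function.Injective φ ∧ ∀ b b', φ (b * b') = φ b * φ b' := by
  have hmn : m ≤ n := by
    rw [hn]
    exact (Nat.le_mul_of_pos_right m (by omega)).trans (Nat.le_add_right _ _)
  obtain ⟨σ, hσ⟩ := exists_ratFunc_ringHom_X_pow K (l := l) (by omega)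
  obtain ⟨τ, hτ⟩ := exists_ratFunc_ringHom_X_pow K one_ne_zero
  rw [pow_one] at hτ
  have hex := exists_linearEquiv_parabolic_jimbo k m σ τ
  rw [hσ, hτ] at hex
  obtain ⟨φ, hφ⟩ := hex
  obtain ⟨ψ, hψ⟩ := exists_algHom_parabolic_jimbo (RatFunc K) k m RatFunc.X (by omega) hmn
  obtain ⟨e⟩ := nonempty_algEquiv_rowQuotient (RatFunc K) k (RatFunc.X ^ l) m
  obtain ⟨e'⟩ := nonempty_algEquiv_rowQuotient (RatFunc K) k RatFunc.X n
  refine ⟨e'.toLinearMap ∘ₗ ψ.toLinearMap ∘ₗ φ.toLinearMap ∘ₗ e.symm.toLinearMap,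
    e'.injective.comp (hψ.comp (φ.injective.comp e.symm.injective)), fun b b' => ?_⟩
  simp [hφ]
end
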